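/- arXiv:1805.06955 — 4 statements merged into one kernel-verified Lean document; each statement's English description precedes it below -/
import Mathlib

section
/- Let 1 ≤ p ≤ 2 and μ₁, μ₂ ∈ M_p(ℝ^d). Then d_{𝕃_p}(μ₁,μ₂)^p = sup { ∫_{ℝ^d} φ(x) dμ₁(x) + ∫_{ℝ^d} ψ(y) dμ₂(y) : (φ,ψ) ∈ Adm^p }, where Adm^p is the set of pairs (φ,ψ) of upper semicontinuous functions with φ ∈ L¹(μ₁), ψ ∈ L¹(μ₂), φ(0) = ψ(0) = 0, and φ(x) + ψ(y) ≤ |x−y|^p for all x, y ∈ ℝ^d. -/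
open MeasureTheory Set Metric Filter
open scoped ENNReal NNReal

noncomputable section

abbrev Euc (d : ℕ) := EuclideanSpace ℝ (Fin d)

variable {d : ℕ} {A B : Type*}

/-- `μ ∈ 𝕃_p(ℝ^d)`: a positive Borel measure on `ℝ^d ∖ {0}` (modeled as a measure on `ℝ^d`
vanishing on `{0}`) with `N_p(μ) = ∫ min(1,|z|^p) dμ < ∞`. -/
def IsLevyLp (p : ℝ) (μ : Measure (Euc d)) : Prop :=
  μ {0} = 0 ∧ ∫⁻ z, ENNReal.ofReal (min 1 (‖z‖ ^ p)) ∂μ < ⊤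

/-- `μ ∈ 𝕃_p(Ω)`: member of `𝕃_p(ℝ^d)` giving no mass to the complement of `Ω`. -/
def IsLevyLpOn (p : ℝ) (Ω : Set (Euc d)) (μ : Measure (Euc d)) : Prop :=
  IsLevyLp p μ ∧ μ Ωᶜ = 0

/-- `μ ∈ M_p(ℝ^d)`: Lévy measure with finite `p`-moment. -/
def IsMp (p : ℝ) (μ : Measure (Euc d)) : Prop :=
  IsLevyLp p μ ∧ ∫⁻ z, ENNReal.ofReal (‖z‖ ^ p) ∂μ < ⊤

/-- Admissible transport plans between `μ₁` and `μ₂`: positive Borel measures on `ℝ^d × ℝ^d`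
with no mass at `(0,0)` whose marginals, restricted to `ℝ^d ∖ {0}`, are `μ₁` and `μ₂`. -/
def AdmPlan (μ₁ μ₂ : Measure (Euc d)) : Set (Measure (Euc d × Euc d)) :=
  {γ | γ {((0 : Euc d), (0 : Euc d))} = 0 ∧
       (γ.map Prod.fst).restrict {(0 : Euc d)}ᶜ = μ₁ ∧
       (γ.map Prod.snd).restrict {(0 : Euc d)}ᶜ = μ₂}

/-- The transport cost functional `J_p(γ) = ∫ |x-y|^p dγ`. -/
def Jp (p : ℝ) (γ : Measure (Euc d × Euc d)) : ℝ≥0∞ :=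
  ∫⁻ q, ENNReal.ofReal (‖q.1 - q.2‖ ^ p) ∂γ

/-- `d_{𝕃_p}(μ,ν)^p` as an extended nonnegative real. -/
def dLpPow (p : ℝ) (μ ν : Measure (Euc d)) : ℝ≥0∞ :=
  ⨅ γ ∈ AdmPlan μ ν, Jp p γ

/-- The transport distance `d_{𝕃_p}`. -/
def dLp (p : ℝ) (μ ν : Measure (Euc d)) : ℝ :=
  (dLpPow p μ ν).toReal ^ (1 / p)

/-- Total variation distance `|μ - ν|(X)` between two positive measures. -/
def dTV {X : Type*} [MeasurableSpace X] (μ ν : Measure X) : ℝ≥0∞ :=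
  (⨆ (s : Set X) (_ : MeasurableSet s), μ s - ν s) +
  (⨆ (s : Set X) (_ : MeasurableSet s), ν s - μ s)

/-- A modulus of continuity. -/
def IsModulus (θ : ℝ → ℝ) : Prop :=
  (∀ r, 0 ≤ θ r) ∧ Monotone θ ∧ Tendsto θ (nhdsWithin 0 (Ioi 0)) (nhds 0)

/-- Bounded uniformly continuous functions on `ℝ^d`. -/
def IsBUC (u : Euc d → ℝ) : Prop :=
  (∃ M, ∀ x, |u x| ≤ M) ∧ UniformContinuous u

/-- The Lévy operator `L_μ(φ,x) = ∫ [φ(x+z) - φ(x) - χ_{B₁}(z) Dφ(x)·z] dμ(z)`. -/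
def Lop (μ : Measure (Euc d)) (φ : Euc d → ℝ) (x : Euc d) : ℝ :=
  ∫ z, (φ (x + z) - φ x -
    (ball (0 : Euc d) 1).indicator (fun w => fderiv ℝ φ x w) z) ∂μ

/-- The operator `I(φ,x) = sup_α inf_β { -L^{αβ}(φ,x) + c_{αβ}(x) φ(x) + f_{αβ}(x) }`. -/
def Iop (μf : Euc d → A → B → Measure (Euc d)) (c f : A → B → Euc d → ℝ)
    (φ : Euc d → ℝ) (x : Euc d) : ℝ :=
  ⨆ α : A, ⨅ β : B, (-(Lop (μf x α β) φ x) + c α β x * φ x + f α β x)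

/-- Viscosity subsolution of `J(u,x) = 0` in `O`. -/
def IsSubsolution (O : Set (Euc d)) (J : (Euc d → ℝ) → Euc d → ℝ) (u : Euc d → ℝ) : Prop :=
  ∀ φ : Euc d → ℝ, ContDiff ℝ 2 φ → (∃ M, ∀ x, |φ x| ≤ M) →
    ∀ x ∈ O, (∀ y, u y - φ y ≤ u x - φ x) → φ x = u x → J φ x ≤ 0

/-- Viscosity supersolution of `J(u,x) = 0` in `O`. -/
def IsSupersolution (O : Set (Euc d)) (J : (Euc d → ℝ) → Euc d → ℝ) (u : Euc d → ℝ) : Prop :=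
  ∀ φ : Euc d → ℝ, ContDiff ℝ 2 φ → (∃ M, ∀ x, |φ x| ≤ M) →
    ∀ x ∈ O, (∀ y, u x - φ x ≤ u y - φ y) → φ x = u x → 0 ≤ J φ x

/-- Assumption A, stated for a family `νhat` (the parts of the Lévy measures near the origin):
Lipschitz continuity in the transport metric `d_{𝕃_p}`. -/
def AssumptionA (O : Set (Euc d)) (p : ℝ) (νhat : Euc d → A → B → Measure (Euc d)) : Prop :=
  ∃ C : ℝ, 0 ≤ C ∧ ∀ x ∈ O, ∀ y ∈ O, ∀ (α : A) (β : B),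
    dLp p (νhat x α β) (νhat y α β) ≤ C * ‖x - y‖

/-- Assumption A1: `s`-Hölder continuity in the transport metric `d_{𝕃_p}`. -/
def AssumptionA1 (O : Set (Euc d)) (p s : ℝ) (νhat : Euc d → A → B → Measure (Euc d)) : Prop :=
  ∃ C : ℝ, 0 < C ∧ ∀ x ∈ O, ∀ y ∈ O, ∀ (α : A) (β : B),
    dLp p (νhat x α β) (νhat y α β) ≤ C * ‖x - y‖ ^ s

/-- Assumption B: continuity in total variation of the tails. -/
def AssumptionB (O : Set (Euc d)) (νcheck : Euc d → A → B → Measure (Euc d)) : Prop :=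
  ∃ θ : ℝ → ℝ, IsModulus θ ∧ ∀ x ∈ O, ∀ y ∈ O, ∀ (α : A) (β : B),
    dTV (νcheck x α β) (νcheck y α β) ≤ ENNReal.ofReal (θ ‖x - y‖)

/-- Assumption C: equicontinuity and uniform boundedness of `f_{αβ}`. -/
def AssumptionC (O : Set (Euc d)) (f : A → B → Euc d → ℝ) : Prop :=
  ∃ θ : ℝ → ℝ, IsModulus θ ∧ ∃ C : ℝ, 0 ≤ C ∧
    (∀ x ∈ O, ∀ y ∈ O, ∀ (α : A) (β : B), |f α β x - f α β y| ≤ θ ‖x - y‖) ∧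
    (∀ x ∈ O, ∀ (α : A) (β : B), |f α β x| ≤ C)

/-- Assumption D: `0 < λ ≤ c_{αβ} ≤ λ₁` and equicontinuity of `c_{αβ}`. -/
def AssumptionD (O : Set (Euc d)) (c : A → B → Euc d → ℝ) : Prop :=
  ∃ lam lam1 : ℝ, 0 < lam ∧ lam ≤ lam1 ∧
    (∀ x ∈ O, ∀ (α : A) (β : B), lam ≤ c α β x ∧ c α β x ≤ lam1) ∧
    ∃ θ : ℝ → ℝ, IsModulus θ ∧
      ∀ x ∈ O, ∀ y ∈ O, ∀ (α : A) (β : B), |c α β x - c α β y| ≤ θ ‖x - y‖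

/-- Assumption E: uniform integrability of the Lévy measures. -/
def AssumptionE (O : Set (Euc d)) (p : ℝ) (μf : Euc d → A → B → Measure (Euc d)) : Prop :=
  (∃ θ : ℝ → ℝ, IsModulus θ ∧ ∀ r : ℝ, 0 < r → ∀ x ∈ O, ∀ (α : A) (β : B),
      ∫⁻ z in ball (0 : Euc d) r, ENNReal.ofReal (‖z‖ ^ p) ∂(μf x α β) ≤ ENNReal.ofReal (θ r)) ∧
  (∃ Λ : ℝ, 0 ≤ Λ ∧ ∀ x ∈ O, ∀ (α : A) (β : B),
      ∫⁻ z, ENNReal.ofReal (min 1 (‖z‖ ^ p)) ∂(μf x α β) ≤ ENNReal.ofReal Λ)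

/-- The smooth approximation `ψ_κ(x) = (κ + |x|²)^{p/2} - κ^{p/2}` of `|x|^p`. -/
def psiK (p κ : ℝ) (x : Euc d) : ℝ := (κ + ‖x‖ ^ 2) ^ (p / 2) - κ ^ (p / 2)

/-- `u` is pointwise-`C^{1,1}` at `x₀`. -/
def PointwiseC11 (u : Euc d → ℝ) (x₀ : Euc d) : Prop :=
  DifferentiableAt ℝ u x₀ ∧ ∃ C : ℝ, 0 < C ∧ ∀ᶠ x in nhds x₀,
    |u x - u x₀ - fderiv ℝ u x₀ (x - x₀)| ≤ C * ‖x - x₀‖ ^ 2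

/-- Sup-convolution `u^δ`. -/
def supConv (δ : ℝ) (u : Euc d → ℝ) (x : Euc d) : ℝ :=
  ⨆ y : Euc d, (u y - ‖x - y‖ ^ 2 / δ)

/-- Inf-convolution `v_δ`. -/
def infConv (δ : ℝ) (v : Euc d → ℝ) (x : Euc d) : ℝ :=
  ⨅ y : Euc d, (v y + ‖x - y‖ ^ 2 / δ)

/-- `(φ,ψ) ∈ Adm^p`, the admissible pairs for the dual problem. -/
def AdmPair (p : ℝ) (μ₁ μ₂ : Measure (Euc d)) (φ ψ : Euc d → ℝ) : Prop :=
  Integrable φ μ₁ ∧ Integrable ψ μ₂ ∧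
  UpperSemicontinuous φ ∧ UpperSemicontinuous ψ ∧
  φ 0 = 0 ∧ ψ 0 = 0 ∧ ∀ x y : Euc d, φ x + ψ y ≤ ‖x - y‖ ^ p

open scoped CompactlySupported BoundedContinuousFunction Topology

section SublinearExtension

variable {E : Type*} [AddCommGroup E] [Module ℝ E]

/-- A sublinear functional dominates a linear one agreeing with it at a given point. -/
lemma exists_linear_le_sublinear (N : E → ℝ)
    (N_hom : ∀ c : ℝ, 0 < c → ∀ x, N (c • x) = c * N x)
    (N_add : ∀ x y, N (x + y) ≤ N x + N y) (x₀ : E) :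
    ∃ Λ : E →ₗ[ℝ] ℝ, (∀ x, Λ x ≤ N x) ∧ Λ x₀ = N x₀ := by
  have N_zero : N 0 = 0 := by
    have := N_hom 2 two_pos 0
    rw [smul_zero] at this
    linarith
  have H : ∀ c : ℝ, c • x₀ = 0 → (RingHom.id ℝ) c • N x₀ = 0 := by
    intro c hc
    rcases smul_eq_zero.1 hc with h | h <;> simp [h, N_zero]
  obtain ⟨Λ, hΛ, hle⟩ := exists_extension_of_le_sublinear
    (LinearPMap.mkSpanSingleton' x₀ (N x₀) H) N N_hom N_add (by
      rintro ⟨x, hx⟩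
      obtain ⟨c, rfl⟩ := Submodule.mem_span_singleton.1 hx
      rw [LinearPMap.mkSpanSingleton'_apply]
      simp only [RingHom.id_apply, smul_eq_mul]
      rcases lt_trichotomy c 0 with hc | rfl | hc
      · have h1 := N_add (c • x₀) ((-c) • x₀)
        rw [N_hom (-c) (neg_pos.2 hc), ← add_smul, add_neg_cancel, zero_smul, N_zero] at h1
        linarith
      · simp [N_zero]
      · exact (N_hom c hc x₀).ge)
  refine ⟨Λ, hle, ?_⟩
  have hx : x₀ ∈ (LinearPMap.mkSpanSingleton' x₀ (N x₀) H).domain :=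
    Submodule.mem_span_singleton_self x₀
  rw [← LinearPMap.mkSpanSingleton'_apply_self x₀ (N x₀) H hx]
  exact hΛ ⟨x₀, hx⟩

/-- Hahn–Banach for the sublinear functional `x ↦ sInf (R x)` attached to a convex relation. -/
lemma exists_linear_le_of_majorants (R : E → Set ℝ) (R_nonempty : ∀ x, (R x).Nonempty)
    (R_bdd : ∀ x, BddBelow (R x))
    (R_smul : ∀ c : ℝ, 0 < c → ∀ x, ∀ s ∈ R x, c * s ∈ R (c • x))
    (R_add : ∀ x y, ∀ s ∈ R x, ∀ t ∈ R y, s + t ∈ R (x + y)) (x₀ : E) :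
    ∃ Λ : E →ₗ[ℝ] ℝ, (∀ x, ∀ s ∈ R x, Λ x ≤ s) ∧ Λ x₀ = sInf (R x₀) := by
  have hom_le : ∀ c : ℝ, 0 < c → ∀ x, sInf (R (c • x)) ≤ c * sInf (R x) := by
    intro c hc x
    rw [← div_le_iff₀' hc]
    refine le_csInf (R_nonempty x) fun s hs => ?_
    rw [div_le_iff₀' hc]
    exact csInf_le (R_bdd _) (R_smul c hc x s hs)
  obtain ⟨Λ, hle, heq⟩ := exists_linear_le_sublinear (fun x => sInf (R x))
    (fun c hc x => by
      refine le_antisymm (hom_le c hc x) ?_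
      have := hom_le c⁻¹ (inv_pos.2 hc) (c • x)
      rwa [inv_smul_smul₀ hc.ne', ← div_eq_inv_mul, le_div_iff₀' hc] at this)
    (fun x y => by
      rw [← sub_le_iff_le_add]
      refine le_csInf (R_nonempty x) fun s hs => ?_
      rw [sub_le_comm]
      refine le_csInf (R_nonempty y) fun t ht => ?_
      rw [sub_le_iff_le_add']
      exact csInf_le (R_bdd _) (R_add x y s hs t ht)) x₀
  exact ⟨Λ, fun x s hs => (hle x).trans (csInf_le (R_bdd x) hs), heq⟩

end SublinearExtension

section WeightedQuotient

variable {Z : Type*} [TopologicalSpace Z]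

/-- A continuous compactly supported truncation of `a / w`, where `w` has compact sublevels. -/
def truncQuot (w : Z → ℝ) (hw : Continuous w) (hK : ∀ t, IsCompact {z | w z ≤ t})
    (a : Z → ℝ) (ha : Continuous a) (n : ℕ) : C_c(Z, ℝ) where
  toFun z := a z * (max 0 (1 - w z / (n + 1)) / max (w z) (1 / (n + 1)))
  continuous_toFun := by
    refine ha.mul (Continuous.div (by fun_prop) (by fun_prop) fun z => ?_)
    have : (0 : ℝ) < 1 / (n + 1) := by positivity
    exact (lt_max_of_lt_right this).ne'
  hasCompactSupport' := by
    refine HasCompactSupport.intro' (hK (n + 1)) (isClosed_le hw continuous_const) fun z hz => ?_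
    have hz' : (n : ℝ) + 1 < w z := not_le.1 hz
    have h1 : 1 - w z / ((n : ℝ) + 1) ≤ 0 := by
      rw [sub_nonpos, le_div_iff₀ (by positivity)]
      linarith
    simp [max_eq_left h1]

variable {w : Z → ℝ} (hw : Continuous w) (hK : ∀ t, IsCompact {z | w z ≤ t})
  {a : Z → ℝ} (ha : Continuous a)

lemma truncQuot_apply (n : ℕ) (z : Z) :
    truncQuot w hw hK a ha n z =
      a z * (max 0 (1 - w z / (n + 1)) / max (w z) (1 / (n + 1))) := rfl

lemma truncQuot_nonneg (ha0 : ∀ z, 0 ≤ a z) (n : ℕ) (z : Z) :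
    0 ≤ truncQuot w hw hK a ha n z := by
  rw [truncQuot_apply]
  have := ha0 z
  positivity

lemma mul_truncQuot_le (hw0 : ∀ z, 0 ≤ w z) (ha0 : ∀ z, 0 ≤ a z) (n : ℕ) (z : Z) :
    w z * truncQuot w hw hK a ha n z ≤ a z := by
  rw [truncQuot_apply]
  have hm : (0 : ℝ) < max (w z) (1 / (n + 1)) := lt_max_of_lt_right (by positivity)
  have hk : max 0 (1 - w z / ((n : ℝ) + 1)) ≤ 1 := by
    have : 0 ≤ w z / ((n : ℝ) + 1) := div_nonneg (hw0 z) (by positivity)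
    exact max_le zero_le_one (by linarith)
  have h1 : w z * (max 0 (1 - w z / ((n : ℝ) + 1)) / max (w z) (1 / (n + 1))) ≤ 1 := by
    rw [← mul_div_assoc, div_le_one hm]
    calc w z * max 0 (1 - w z / ((n : ℝ) + 1)) ≤ w z * 1 :=
          mul_le_mul_of_nonneg_left hk (hw0 z)
      _ ≤ _ := by rw [mul_one]; exact le_max_left _ _
  calc _ = a z * (w z * (max 0 (1 - w z / ((n : ℝ) + 1)) / max (w z) (1 / (n + 1)))) := by ring
    _ ≤ a z := mul_le_of_le_one_right (ha0 z) h1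

lemma truncQuot_le_div (hw0 : ∀ z, 0 ≤ w z) (ha0 : ∀ z, 0 ≤ a z)
    (haw : ∀ z, w z = 0 → a z = 0) (n : ℕ) (z : Z) :
    truncQuot w hw hK a ha n z ≤ a z / w z := by
  rcases (hw0 z).eq_or_lt with h | h
  · simp [truncQuot_apply, haw z h.symm]
  · rw [le_div_iff₀' h]
    exact mul_truncQuot_le hw hK ha hw0 ha0 n z

lemma le_mul_truncQuot_add (hw0 : ∀ z, 0 ≤ w z) (ha0 : ∀ z, 0 ≤ a z) {C : ℝ}
    (haC : ∀ z, a z ≤ C) (haw : ∀ z, a z ≤ C * w z ^ 2) (n : ℕ) (z : Z) :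
    a z ≤ w z * truncQuot w hw hK a ha n z + 2 * C / (n + 1) * w z := by
  rw [truncQuot_apply]
  have hN : (0 : ℝ) < n + 1 := by positivity
  have hw := hw0 z
  have ha := ha0 z
  set N : ℝ := n + 1
  have hC : 0 ≤ C := ha.trans (haC z)
  have hm : (0 : ℝ) < max (w z) (1 / N) := lt_max_of_lt_right (by positivity)
  set k := max 0 (1 - w z / N) with hk
  set m := w z / max (w z) (1 / N) with hmdef
  have hk1 : k ≤ 1 := by
    have : 0 ≤ w z / N := by positivity
    exact max_le zero_le_one (by linarith)
  have hm1 : m ≤ 1 := (div_le_one hm).2 (le_max_left _ _)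
  have h1 : a z * (1 - k) ≤ C * (w z / N) := by
    have : 1 - w z / N ≤ k := le_max_right _ _
    exact mul_le_mul (haC z) (by linarith) (by linarith) hC
  have h2 : a z * (1 - m) ≤ C * (w z / N) := by
    rcases le_total (1 / N) (w z) with h | h
    · have hz : 0 < w z := lt_of_lt_of_le (by positivity) h
      rw [hmdef, max_eq_left h, div_self hz.ne']
      simp only [sub_self, mul_zero]
      positivity
    · have hm0 : 0 ≤ m := by positivity
      calc a z * (1 - m) ≤ a z * 1 := mul_le_mul_of_nonneg_left (by linarith) ha
        _ ≤ C * w z ^ 2 := by rw [mul_one]; exact haw z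
        _ = C * (w z * w z) := by ring
        _ ≤ C * (w z * (1 / N)) := by gcongr
        _ = _ := by ring
  have h3 : 0 ≤ a z * ((1 - k) * (1 - m)) :=
    mul_nonneg ha (mul_nonneg (by linarith) (by linarith))
  have h4 : w z * (a z * (k / max (w z) (1 / N))) = a z * (k * m) := by
    rw [hmdef]; ring
  have h5 : 2 * C / N * w z = 2 * (C * (w z / N)) := by ring
  rw [h4, h5]
  nlinarith

lemma tendsto_truncQuot (hw0 : ∀ z, 0 ≤ w z) (haw : ∀ z, w z = 0 → a z = 0) (z : Z) :
    Tendsto (fun n => truncQuot w hw hK a ha n z) atTop (𝓝 (a z / w z)) := by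
  simp only [truncQuot_apply]
  rcases (hw0 z).eq_or_lt with h | h
  · simp [haw z h.symm]
  · have h1 : Tendsto (fun n : ℕ => (1 : ℝ) / (n + 1)) atTop (𝓝 0) :=
      tendsto_one_div_add_atTop_nhds_zero_nat
    have h2 : Tendsto (fun n : ℕ => max 0 (1 - w z * (1 / ((n : ℝ) + 1)))) atTop
        (𝓝 (max 0 (1 - w z * 0))) := tendsto_const_nhds.max (tendsto_const_nhds.sub (h1.const_mul _))
    have h3 : Tendsto (fun n : ℕ => max (w z) (1 / ((n : ℝ) + 1))) atTop (𝓝 (max (w z) 0)) :=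
      tendsto_const_nhds.max h1
    rw [max_eq_left h.le] at h3
    have := (h2.div h3 h.ne').const_mul (a z)
    simpa [div_eq_mul_inv] using this

variable [MeasurableSpace Z] [BorelSpace Z] (m : Measure Z)

lemma lintegral_div_le_of_forall_integral_le (hw : Continuous w)
    (hK : ∀ t, IsCompact {z | w z ≤ t}) (ha : Continuous a) (hw0 : ∀ z, 0 ≤ w z) (ha0 : ∀ z, 0 ≤ a z)
    (haw : ∀ z, w z = 0 → a z = 0) [IsFiniteMeasureOnCompacts m] {A : ℝ}
    (hA : ∀ g : C_c(Z, ℝ), (∀ z, w z * g z ≤ a z) → ∫ z, g z ∂m ≤ A) :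
    ∫⁻ z, ENNReal.ofReal (a z / w z) ∂m ≤ ENNReal.ofReal A := by
  set g := truncQuot w hw hK a ha
  calc ∫⁻ z, ENNReal.ofReal (a z / w z) ∂m
      = ∫⁻ z, liminf (fun n => ENNReal.ofReal (g n z)) atTop ∂m := by
        refine lintegral_congr fun z => ?_
        exact (((ENNReal.continuous_ofReal.tendsto _).comp
          (tendsto_truncQuot hw hK ha hw0 haw z)).liminf_eq).symm
    _ ≤ liminf (fun n => ∫⁻ z, ENNReal.ofReal (g n z) ∂m) atTop :=
        lintegral_liminf_le fun n => (g n).continuous.measurable.ennreal_ofReal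
    _ ≤ ENNReal.ofReal A := by
        refine liminf_le_of_le (by isBoundedDefault) fun b hb => ?_
        obtain ⟨n, hn⟩ := hb.exists
        refine hn.trans ?_
        rw [← ofReal_integral_eq_lintegral_ofReal (f := g n)
          ((g n).continuous.integrable_of_hasCompactSupport (g n).hasCompactSupport)
          (ae_of_all _ (truncQuot_nonneg hw hK ha ha0 n))]
        exact ENNReal.ofReal_le_ofReal (hA _ (mul_truncQuot_le hw hK ha hw0 ha0 n))

lemma le_lintegral_div_of_forall_le_integral (hw : Continuous w)
    (hK : ∀ t, IsCompact {z | w z ≤ t}) (ha : Continuous a) (hw0 : ∀ z, 0 ≤ w z) (ha0 : ∀ z, 0 ≤ a z) {C : ℝ}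
    (haC : ∀ z, a z ≤ C) (haw : ∀ z, a z ≤ C * w z ^ 2) [IsFiniteMeasureOnCompacts m] {A M : ℝ}
    (hA : ∀ g : C_c(Z, ℝ), ∀ ε, (∀ z, a z ≤ w z * g z + ε * w z) → A ≤ ∫ z, g z ∂m + ε * M) :
    ENNReal.ofReal A ≤ ∫⁻ z, ENNReal.ofReal (a z / w z) ∂m := by
  by_cases htop : ∫⁻ z, ENNReal.ofReal (a z / w z) ∂m = ⊤
  · simp [htop]
  set g := truncQuot w hw hK a ha
  have haw' : ∀ z, w z = 0 → a z = 0 := fun z hz =>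
    le_antisymm ((haw z).trans (by simp [hz])) (ha0 z)
  have hle : ∀ n : ℕ, A ≤ (∫⁻ z, ENNReal.ofReal (a z / w z) ∂m).toReal +
      2 * C * (1 / ((n : ℝ) + 1)) * M := by
    intro n
    have h1 := hA (g n) (2 * C / (n + 1)) (le_mul_truncQuot_add hw hK ha hw0 ha0 haC haw n)
    have h2 : ∫ z, g n z ∂m ≤ (∫⁻ z, ENNReal.ofReal (a z / w z) ∂m).toReal := by
      rw [integral_eq_lintegral_of_nonneg_ae (ae_of_all _ (truncQuot_nonneg hw hK ha ha0 n))
        (g n).continuous.aestronglyMeasurable]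
      exact ENNReal.toReal_mono htop (lintegral_mono fun z =>
        ENNReal.ofReal_le_ofReal (truncQuot_le_div hw hK ha hw0 ha0 haw' n z))
    have h3 : 2 * C / ((n : ℝ) + 1) = 2 * C * (1 / ((n : ℝ) + 1)) := by ring
    rw [h3] at h1
    linarith
  have hlim : Tendsto (fun n : ℕ => (∫⁻ z, ENNReal.ofReal (a z / w z) ∂m).toReal +
      2 * C * (1 / ((n : ℝ) + 1)) * M) atTop
      (𝓝 ((∫⁻ z, ENNReal.ofReal (a z / w z) ∂m).toReal + 2 * C * 0 * M)) :=
    tendsto_const_nhds.add ((tendsto_one_div_add_atTop_nhds_zero_nat.const_mul _).mul_const _)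
  rw [mul_zero, zero_mul, add_zero] at hlim
  exact ENNReal.ofReal_le_of_le_toReal (ge_of_tendsto' hlim hle)

end WeightedQuotient

section TransportWeight

lemma continuous_norm_rpow {p : ℝ} (hp : 1 ≤ p) : Continuous fun x : Euc d => ‖x‖ ^ p :=
  continuous_norm.rpow_const fun _ => Or.inr (by linarith)

/-- The weight `|x|^p + |y|^p` on the product space. -/
def transportWeight (p : ℝ) (z : Euc d × Euc d) : ℝ := ‖z.1‖ ^ p + ‖z.2‖ ^ p

lemma continuous_transportWeight {p : ℝ} (hp : 1 ≤ p) :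
    Continuous (transportWeight (d := d) p) :=
  ((continuous_norm_rpow hp).comp continuous_fst).add
    ((continuous_norm_rpow hp).comp continuous_snd)

lemma transportWeight_nonneg (p : ℝ) (z : Euc d × Euc d) : 0 ≤ transportWeight p z := by
  unfold transportWeight
  positivity

lemma isCompact_transportWeight_le {p : ℝ} (hp : 1 ≤ p) (t : ℝ) :
    IsCompact {z : Euc d × Euc d | transportWeight p z ≤ t} := by
  refine Metric.isCompact_of_isClosed_isBounded
    (isClosed_le (continuous_transportWeight hp) continuous_const) ?_
  refine (Metric.isBounded_closedBall (x := (0 : Euc d × Euc d)) (r := 1 + |t|)).subset ?_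
  intro z hz
  have hz' : ‖z.1‖ ^ p + ‖z.2‖ ^ p ≤ t := hz
  have key : ∀ x : Euc d, ‖x‖ ^ p ≤ t → ‖x‖ ≤ 1 + |t| := by
    intro x hx
    rcases le_total ‖x‖ 1 with h | h
    · linarith [abs_nonneg t]
    · linarith [Real.self_le_rpow_of_one_le h hp, le_abs_self t]
  have h1 : 0 ≤ ‖z.1‖ ^ p := by positivity
  have h2 : 0 ≤ ‖z.2‖ ^ p := by positivity
  rw [mem_closedBall_zero_iff, Prod.norm_def]
  exact max_le (key _ (by linarith)) (key _ (by linarith))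

lemma norm_sub_rpow_le {p : ℝ} (hp : 1 ≤ p) (z : Euc d × Euc d) :
    ‖z.1 - z.2‖ ^ p ≤ 2 ^ p * transportWeight p z := by
  have hp0 : 0 ≤ p := by linarith
  have h1 : 0 ≤ ‖z.1‖ ^ p := by positivity
  have h2 : 0 ≤ ‖z.2‖ ^ p := by positivity
  have h3 := norm_sub_le z.1 z.2
  unfold transportWeight
  rcases le_total ‖z.1‖ ‖z.2‖ with h | h
  · calc ‖z.1 - z.2‖ ^ p ≤ (2 * ‖z.2‖) ^ p :=
          Real.rpow_le_rpow (norm_nonneg _) (by linarith) hp0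
      _ = 2 ^ p * ‖z.2‖ ^ p := Real.mul_rpow zero_le_two (norm_nonneg _)
      _ ≤ _ := by gcongr; linarith
  · calc ‖z.1 - z.2‖ ^ p ≤ (2 * ‖z.1‖) ^ p :=
          Real.rpow_le_rpow (norm_nonneg _) (by linarith) hp0
      _ = 2 ^ p * ‖z.1‖ ^ p := Real.mul_rpow zero_le_two (norm_nonneg _)
      _ ≤ _ := by gcongr; linarith

lemma norm_sub_rpow_eq_zero {p : ℝ} (hp : 1 ≤ p) (z : Euc d × Euc d)
    (hz : transportWeight p z = 0) : ‖z.1 - z.2‖ ^ p = 0 :=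
  le_antisymm ((norm_sub_rpow_le hp z).trans (by simp [hz])) (by positivity)

lemma IsMp.integrable_norm_rpow {p : ℝ} (hp : 1 ≤ p) {μ : Measure (Euc d)} (h : IsMp p μ) :
    Integrable (fun x => ‖x‖ ^ p) μ := by
  refine ⟨(continuous_norm_rpow hp).aestronglyMeasurable, ?_⟩
  rw [hasFiniteIntegral_iff_ofReal (ae_of_all _ fun x => by positivity)]
  exact h.2

end TransportWeight

section Duality

/-- Values of `∫ φ dμ₁ + ∫ ψ dμ₂` over continuous integrable pairs vanishing at the origin
with `h(x, y) ≤ φ(x) + ψ(y)`. -/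
def dualMajorants (μ₁ μ₂ : Measure (Euc d)) (h : Euc d × Euc d → ℝ) : Set ℝ :=
  {s | ∃ φ ψ : Euc d → ℝ, (Continuous φ ∧ φ 0 = 0 ∧ Integrable φ μ₁) ∧
    (Continuous ψ ∧ ψ 0 = 0 ∧ Integrable ψ μ₂) ∧ (∀ z, h z ≤ φ z.1 + ψ z.2) ∧
    s = ∫ x, φ x ∂μ₁ + ∫ y, ψ y ∂μ₂}

variable {μ₁ μ₂ : Measure (Euc d)} {h k : Euc d × Euc d → ℝ}

lemma dualMajorants_smul {c s : ℝ} (hc : 0 < c) (hs : s ∈ dualMajorants μ₁ μ₂ h) :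
    c * s ∈ dualMajorants μ₁ μ₂ fun z => c * h z := by
  obtain ⟨φ, ψ, ⟨hφ, hφ0, hφi⟩, ⟨hψ, hψ0, hψi⟩, hle, rfl⟩ := hs
  refine ⟨fun x => c * φ x, fun y => c * ψ y, ⟨by fun_prop, by simp [hφ0], hφi.const_mul c⟩,
    ⟨by fun_prop, by simp [hψ0], hψi.const_mul c⟩, fun z => ?_, ?_⟩
  · rw [← mul_add]
    exact mul_le_mul_of_nonneg_left (hle z) hc.le
  · rw [integral_const_mul, integral_const_mul, mul_add]

lemma dualMajorants_add {s t : ℝ} (hs : s ∈ dualMajorants μ₁ μ₂ h)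
    (ht : t ∈ dualMajorants μ₁ μ₂ k) : s + t ∈ dualMajorants μ₁ μ₂ fun z => h z + k z := by
  obtain ⟨φ, ψ, ⟨hφ, hφ0, hφi⟩, ⟨hψ, hψ0, hψi⟩, hle, rfl⟩ := hs
  obtain ⟨φ', ψ', ⟨hφ', hφ0', hφi'⟩, ⟨hψ', hψ0', hψi'⟩, hle', rfl⟩ := ht
  refine ⟨fun x => φ x + φ' x, fun y => ψ y + ψ' y,
    ⟨by fun_prop, by simp [hφ0, hφ0'], hφi.add hφi'⟩,
    ⟨by fun_prop, by simp [hψ0, hψ0'], hψi.add hψi'⟩, fun z => ?_, ?_⟩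
  · linarith [hle z, hle' z]
  · rw [integral_add hφi hφi', integral_add hψi hψi']
    ring

lemma zero_mem_dualMajorants (hh : ∀ z, h z ≤ 0) : 0 ∈ dualMajorants μ₁ μ₂ h :=
  ⟨fun _ => 0, fun _ => 0, ⟨continuous_const, rfl, integrable_zero _ _ _⟩,
    ⟨continuous_const, rfl, integrable_zero _ _ _⟩, by simpa using hh, by simp⟩

lemma mul_mem_dualMajorants {p : ℝ} (hp : 1 ≤ p) (h₁ : IsMp p μ₁) (h₂ : IsMp p μ₂) {C : ℝ}
    (hC : ∀ z, h z ≤ C * transportWeight p z) :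
    C * (∫ x, ‖x‖ ^ p ∂μ₁ + ∫ y, ‖y‖ ^ p ∂μ₂) ∈ dualMajorants μ₁ μ₂ h := by
  have hp0 : p ≠ 0 := by linarith
  refine ⟨fun x => C * ‖x‖ ^ p, fun y => C * ‖y‖ ^ p,
    ⟨(continuous_norm_rpow hp).const_mul C, by simp [hp0],
      (h₁.integrable_norm_rpow hp).const_mul C⟩,
    ⟨(continuous_norm_rpow hp).const_mul C, by simp [hp0],
      (h₂.integrable_norm_rpow hp).const_mul C⟩, fun z => ?_, ?_⟩
  · rw [← mul_add]
    exact hC z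
  · rw [integral_const_mul, integral_const_mul, mul_add]

lemma bddBelow_dualMajorants {p : ℝ} (hp : 1 ≤ p) (h₁ : IsMp p μ₁) (h₂ : IsMp p μ₂) {C : ℝ}
    (hC : ∀ z, -C * transportWeight p z ≤ h z) : BddBelow (dualMajorants μ₁ μ₂ h) := by
  have hp0 : p ≠ 0 := by linarith
  refine ⟨-C * (∫ x, ‖x‖ ^ p ∂μ₁ + ∫ y, ‖y‖ ^ p ∂μ₂), ?_⟩
  rintro s ⟨φ, ψ, ⟨hφ, hφ0, hφi⟩, ⟨hψ, hψ0, hψi⟩, hle, rfl⟩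
  rw [mul_add, ← integral_const_mul, ← integral_const_mul]
  refine add_le_add
    (integral_mono ((h₁.integrable_norm_rpow hp).const_mul _) hφi fun x => ?_)
    (integral_mono ((h₂.integrable_norm_rpow hp).const_mul _) hψi fun y => ?_)
  · simpa [transportWeight, hp0, hψ0] using (hC (x, 0)).trans (hle (x, 0))
  · simpa [transportWeight, hp0, hφ0] using (hC (0, y)).trans (hle (0, y))

/-- A Radon measure `m` representing an optimal dual functional: it is to be thought of as
the transport weight times an optimal plan. -/
lemma exists_weighted_plan {p : ℝ} (hp : 1 ≤ p) (h₁ : IsMp p μ₁) (h₂ : IsMp p μ₂) :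
    ∃ m : Measure (Euc d × Euc d), IsFiniteMeasureOnCompacts m ∧
      (∀ g : C_c(Euc d × Euc d, ℝ), (∀ z, transportWeight p z * g z ≤ ‖z.1 - z.2‖ ^ p) →
        ∫ z, g z ∂m ≤ -sInf (dualMajorants μ₁ μ₂ fun z => -‖z.1 - z.2‖ ^ p)) ∧
      ∀ g : C_c(Euc d × Euc d, ℝ), ∀ s ∈ dualMajorants μ₁ μ₂ fun z => transportWeight p z * g z,
        ∫ z, g z ∂m ≤ s := by
  let R : ℝ × C_c(Euc d × Euc d, ℝ) → Set ℝ := fun q =>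
    dualMajorants μ₁ μ₂ fun z => q.1 * ‖z.1 - z.2‖ ^ p + transportWeight p z * q.2 z
  have bound : ∀ q : ℝ × C_c(Euc d × Euc d, ℝ), ∃ C, ∀ z,
      |q.1 * ‖z.1 - z.2‖ ^ p + transportWeight p z * q.2 z| ≤ C * transportWeight p z := by
    intro q
    obtain ⟨B, hB⟩ := q.2.hasCompactSupport.exists_bound_of_continuous q.2.continuous
    refine ⟨|q.1| * 2 ^ p + B, fun z => ?_⟩
    have hw := transportWeight_nonneg p z
    have hc : |‖z.1 - z.2‖ ^ p| ≤ 2 ^ p * transportWeight p z := by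
      rw [abs_of_nonneg (by positivity)]
      exact norm_sub_rpow_le hp z
    calc _ ≤ |q.1| * |‖z.1 - z.2‖ ^ p| + transportWeight p z * |q.2 z| := by
          refine (abs_add_le _ _).trans_eq ?_
          rw [abs_mul, abs_mul, abs_of_nonneg hw]
      _ ≤ |q.1| * (2 ^ p * transportWeight p z) + transportWeight p z * B := by
          gcongr
          exact hB z
      _ = _ := by ring
  obtain ⟨Λ, hle, heq⟩ := exists_linear_le_of_majorants R
    (fun q => by
      obtain ⟨C, hC⟩ := bound q
      exact ⟨_, mul_mem_dualMajorants hp h₁ h₂ fun z => (le_abs_self _).trans (hC z)⟩)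
    (fun q => by
      obtain ⟨C, hC⟩ := bound q
      exact bddBelow_dualMajorants hp h₁ h₂ (C := C) fun z => by
        rw [neg_mul]
        exact (abs_le.1 (hC z)).1)
    (fun c hc q s hs => by
      convert dualMajorants_smul hc hs using 2
      funext z
      simp
      ring)
    (fun q q' s hs t ht => by
      convert dualMajorants_add hs ht using 2
      funext z
      simp
      ring) (-1, 0)
  let T : C_c(Euc d × Euc d, ℝ) →ₚ[ℝ] ℝ :=
    PositiveLinearMap.mk₀ (Λ.comp (LinearMap.inr ℝ ℝ C_c(Euc d × Euc d, ℝ))) fun g hg => by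
      have h1 : Λ (0, -g) ≤ 0 := hle _ _ (zero_mem_dualMajorants fun z => by
        have := mul_nonneg (transportWeight_nonneg p z) (show 0 ≤ g z from hg z)
        simpa using this)
      have h2 : ((0 : ℝ), -g) = -((0 : ℝ), g) := by simp
      rw [h2, map_neg] at h1
      simpa using h1
  have hT : ∀ g, ∫ z, g z ∂(RealRMK.rieszMeasure T) = Λ (0, g) :=
    fun g => RealRMK.integral_rieszMeasure T g
  refine ⟨RealRMK.rieszMeasure T, inferInstance, fun g hg => ?_, fun g s hs => ?_⟩
  · have h1 : Λ (-1, g) ≤ 0 := hle _ _ (zero_mem_dualMajorants fun z => by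
      have := hg z
      dsimp only
      linarith)
    have h2 : ((-1 : ℝ), g) = (-1, 0) + (0, g) := by simp
    have h3 : R (-1, 0) = dualMajorants μ₁ μ₂ fun z => -‖z.1 - z.2‖ ^ p := by simp [R]
    rw [h2, map_add, heq, h3] at h1
    rw [hT]
    linarith
  · rw [hT]
    exact hle _ _ (by simpa [R] using hs)

end Duality

section Marginals

lemma restrict_eq_of_withDensity_eq {Ω : Type*} [MeasurableSpace Ω] {μ ν : Measure Ω}
    {v : Ω → ℝ≥0∞} (hv : Measurable v) {s : Set Ω} (hs : MeasurableSet s)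
    (hv0 : ∀ x ∈ s, v x ≠ 0) (hv_top : ∀ x, v x ≠ ⊤) (h : μ.withDensity v = ν.withDensity v) :
    μ.restrict s = ν.restrict s := by
  have key : ∀ ρ : Measure Ω, ((ρ.withDensity v).restrict s).withDensity v⁻¹ = ρ.restrict s := by
    intro ρ
    rw [restrict_withDensity hs]
    exact withDensity_inv_same hv (ae_restrict_of_forall_mem hs hv0) (ae_of_all _ hv_top)
  rw [← key μ, h, key ν]

lemma lintegral_withDensity_one_div_transportWeight {p : ℝ} (hp : 1 ≤ p)
    (m : Measure (Euc d × Euc d)) {a : Euc d × Euc d → ℝ} (ha : Measurable a) :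
    ∫⁻ z, ENNReal.ofReal (a z) ∂(m.withDensity fun z => ENNReal.ofReal (1 / transportWeight p z))
      = ∫⁻ z, ENNReal.ofReal (a z / transportWeight p z) ∂m := by
  have hmeas : Measurable fun z : Euc d × Euc d => ENNReal.ofReal (1 / transportWeight p z) :=
    (measurable_const.div (continuous_transportWeight hp).measurable).ennreal_ofReal
  rw [lintegral_withDensity_eq_lintegral_mul _ hmeas ha.ennreal_ofReal]
  refine lintegral_congr fun z => ?_
  rw [Pi.mul_apply, ← ENNReal.ofReal_mul (one_div_nonneg.2 (transportWeight_nonneg p z)),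
    one_div_mul_eq_div]

lemma map_restrict_compl_zero_eq {p : ℝ} (hp : 1 ≤ p) {μ : Measure (Euc d)} (hμ : IsMp p μ)
    (m : Measure (Euc d × Euc d)) [IsFiniteMeasureOnCompacts m] {π : Euc d × Euc d → Euc d}
    (hπ : Continuous π) (hπw : ∀ z, ‖π z‖ ^ p ≤ transportWeight p z) {M : ℝ}
    (hle : ∀ g : C_c(Euc d × Euc d, ℝ), ∀ φ : Euc d → ℝ, Continuous φ → φ 0 = 0 →
      Integrable φ μ → (∀ z, transportWeight p z * g z ≤ φ (π z)) → ∫ z, g z ∂m ≤ ∫ x, φ x ∂μ)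
    (hge : ∀ g : C_c(Euc d × Euc d, ℝ), ∀ φ : Euc d → ℝ, ∀ ε, Continuous φ → φ 0 = 0 →
      Integrable φ μ → (∀ z, φ (π z) ≤ transportWeight p z * g z + ε * transportWeight p z) →
      ∫ x, φ x ∂μ ≤ ∫ z, g z ∂m + ε * M) :
    ((m.withDensity fun z => ENNReal.ofReal (1 / transportWeight p z)).map π).restrict {0}ᶜ
      = μ := by
  have hp0 : p ≠ 0 := by linarith
  have hr := continuous_norm_rpow (d := d) hp
  have hw := continuous_transportWeight (d := d) hp
  set u : Euc d → ℝ := fun x => min 1 (‖x‖ ^ p) ^ 2 with hu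
  have hu_cont : Continuous u := (continuous_const.min hr).pow 2
  have hu0 : u 0 = 0 := by simp [hu, hp0]
  have hu_nonneg : ∀ x, 0 ≤ u x := fun x => sq_nonneg _
  have hmin : ∀ x : Euc d, 0 ≤ min 1 (‖x‖ ^ p) := fun x => le_min zero_le_one (by positivity)
  have hu_le_one : ∀ x, u x ≤ 1 := fun x => pow_le_one₀ (hmin x) (min_le_left _ _)
  have hu_le : ∀ x, u x ≤ ‖x‖ ^ p := fun x =>
    (pow_le_of_le_one (hmin x) (min_le_left _ _) two_ne_zero).trans (min_le_right _ _)
  have hu_le_sq : ∀ x, u x ≤ (‖x‖ ^ p) ^ 2 := fun x =>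
    pow_le_pow_left₀ (hmin x) (min_le_right _ _) 2
  have hu_int : Integrable u μ :=
    (hμ.integrable_norm_rpow hp).mono' hu_cont.aestronglyMeasurable
      (ae_of_all _ fun x => by rw [Real.norm_of_nonneg (hu_nonneg x)]; exact hu_le x)
  set v : Euc d → ℝ≥0∞ := fun x => ENNReal.ofReal (u x)
  have hv : Measurable v := hu_cont.measurable.ennreal_ofReal
  have hμ0 : μ.restrict {0}ᶜ = μ := by
    refine Measure.restrict_eq_self_of_ae_mem ?_
    rw [ae_iff]
    simpa using hμ.1.1
  conv_rhs => rw [← hμ0]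
  refine restrict_eq_of_withDensity_eq hv (measurableSet_singleton 0).compl ?_
    (fun x => ENNReal.ofReal_ne_top) (Eq.symm ?_)
  · intro x hx
    have : 0 < ‖x‖ ^ p := Real.rpow_pos_of_pos (norm_pos_iff.2 hx) p
    simp only [v, ne_eq, ENNReal.ofReal_eq_zero, not_le]
    exact pow_pos (lt_min one_pos this) 2
  have : IsFiniteMeasure (μ.withDensity v) := isFiniteMeasure_withDensity_ofReal hu_int.2
  refine ext_of_forall_lintegral_eq_of_IsFiniteMeasure fun f => ?_
  have hf_cont : Continuous fun x => (f x : ℝ) := NNReal.continuous_coe.comp f.continuous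
  have hf_meas : Measurable fun x => (f x : ℝ≥0∞) := f.continuous.measurable.coe_nnreal_ennreal
  have hf_le : ∀ x, (f x : ℝ) ≤ nndist f 0 := fun x =>
    NNReal.coe_le_coe.2 (BoundedContinuousFunction.NNReal.upper_bound f x)
  set C : ℝ := ((nndist f 0 : ℝ≥0) : ℝ)
  have hC : 0 ≤ C := NNReal.coe_nonneg _
  set b : Euc d → ℝ := fun x => f x * u x with hb
  have hb_cont : Continuous b := hf_cont.mul hu_cont
  have hb_nonneg : ∀ x, 0 ≤ b x := fun x => mul_nonneg (NNReal.coe_nonneg _) (hu_nonneg x)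
  have hb0 : b 0 = 0 := by simp [hb, hu0]
  have hb_le : ∀ x, b x ≤ C * u x := fun x =>
    mul_le_mul_of_nonneg_right (hf_le x) (hu_nonneg x)
  have hb_int : Integrable b μ :=
    (hu_int.const_mul C).mono' hb_cont.aestronglyMeasurable
      (ae_of_all _ fun x => by rw [Real.norm_of_nonneg (hb_nonneg x)]; exact hb_le x)
  have hvf : ∀ x, (v * fun x => (f x : ℝ≥0∞)) x = ENNReal.ofReal (b x) := by
    intro x
    simp only [Pi.mul_apply, v, b]
    rw [ENNReal.ofReal_mul (NNReal.coe_nonneg _), ENNReal.ofReal_coe_nnreal, mul_comm]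
  have hw0 := transportWeight_nonneg (d := d) p
  have hK := isCompact_transportWeight_le (d := d) hp
  have hbw : ∀ z, b (π z) ≤ C * transportWeight p z ^ 2 := fun z =>
    (hb_le _).trans (mul_le_mul_of_nonneg_left ((hu_le_sq _).trans
      (pow_le_pow_left₀ (by positivity) (hπw z) 2)) hC)
  rw [lintegral_withDensity_eq_lintegral_mul _ hv hf_meas,
    lintegral_withDensity_eq_lintegral_mul _ hv hf_meas]
  simp only [hvf]
  rw [lintegral_map hb_cont.measurable.ennreal_ofReal hπ.measurable,
    lintegral_withDensity_one_div_transportWeight hp m (a := fun z => b (π z))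
      (hb_cont.comp hπ).measurable,
    ← ofReal_integral_eq_lintegral_ofReal hb_int (ae_of_all _ hb_nonneg)]
  refine le_antisymm ?_ ?_
  · exact le_lintegral_div_of_forall_le_integral m hw hK (hb_cont.comp hπ) hw0
      (fun z => hb_nonneg _)
      (fun z => (hb_le _).trans (mul_le_of_le_one_right hC (hu_le_one _))) hbw
      fun g ε hg => hge g b ε hb_cont hb0 hb_int hg
  · exact lintegral_div_le_of_forall_integral_le m hw hK (hb_cont.comp hπ) hw0
      (fun z => hb_nonneg _)
      (fun z hz => le_antisymm ((hbw z).trans (by simp [hz])) (hb_nonneg _))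
      fun g hg => hle g b hb_cont hb0 hb_int hg

variable {μ₁ μ₂ : Measure (Euc d)}

lemma exists_admPlan_Jp_le {p : ℝ} (hp : 1 ≤ p) (h₁ : IsMp p μ₁) (h₂ : IsMp p μ₂) :
    ∃ γ ∈ AdmPlan μ₁ μ₂,
      Jp p γ ≤ ENNReal.ofReal (-sInf (dualMajorants μ₁ μ₂ fun z => -‖z.1 - z.2‖ ^ p)) := by
  have hp0 : p ≠ 0 := by linarith
  have hr := continuous_norm_rpow (d := d) hp
  have hw := continuous_transportWeight (d := d) hp
  have hw0 := transportWeight_nonneg (d := d) p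
  have hi₁ := h₁.integrable_norm_rpow hp
  have hi₂ := h₂.integrable_norm_rpow hp
  obtain ⟨m, hm, hcost, hmaj⟩ := exists_weighted_plan hp h₁ h₂
  have hcont : Continuous fun z : Euc d × Euc d => ‖z.1 - z.2‖ ^ p :=
    hr.comp (continuous_fst.sub continuous_snd)
  refine ⟨m.withDensity fun z => ENNReal.ofReal (1 / transportWeight p z), ⟨?_, ?_, ?_⟩, ?_⟩
  · rw [withDensity_apply _ (measurableSet_singleton _), lintegral_singleton]
    simp [transportWeight, hp0]
  · refine map_restrict_compl_zero_eq hp h₁ m continuous_fst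
      (fun z => le_add_of_nonneg_right (by positivity))
      (M := ∫ x, ‖x‖ ^ p ∂μ₁ + ∫ y, ‖y‖ ^ p ∂μ₂) ?_ ?_
    · intro g φ hφ hφ0 hφi hg
      exact hmaj g _ ⟨φ, fun _ => 0, ⟨hφ, hφ0, hφi⟩,
        ⟨continuous_const, rfl, integrable_zero _ _ _⟩, by simpa using hg, by simp⟩
    · intro g φ ε hφ hφ0 hφi hg
      have := hmaj (-g) _ ⟨fun x => ε * ‖x‖ ^ p - φ x, fun y => ε * ‖y‖ ^ p,
        ⟨(hr.const_mul ε).sub hφ, by simp [hp0, hφ0], (hi₁.const_mul ε).sub hφi⟩,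
        ⟨hr.const_mul ε, by simp [hp0], hi₂.const_mul ε⟩, fun z => ?_, rfl⟩
      · rw [integral_sub (hi₁.const_mul ε) hφi, integral_const_mul, integral_const_mul] at this
        simp only [CompactlySupportedContinuousMap.coe_neg, Pi.neg_apply, integral_neg] at this
        linarith
      · have := hg z
        simp only [CompactlySupportedContinuousMap.coe_neg, Pi.neg_apply]
        unfold transportWeight at *
        linarith
  · refine map_restrict_compl_zero_eq hp h₂ m continuous_snd
      (fun z => le_add_of_nonneg_left (by positivity))
      (M := ∫ x, ‖x‖ ^ p ∂μ₁ + ∫ y, ‖y‖ ^ p ∂μ₂) ?_ ?_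
    · intro g φ hφ hφ0 hφi hg
      exact hmaj g _ ⟨fun _ => 0, φ, ⟨continuous_const, rfl, integrable_zero _ _ _⟩,
        ⟨hφ, hφ0, hφi⟩, by simpa using hg, by simp⟩
    · intro g φ ε hφ hφ0 hφi hg
      have := hmaj (-g) _ ⟨fun x => ε * ‖x‖ ^ p, fun y => ε * ‖y‖ ^ p - φ y,
        ⟨hr.const_mul ε, by simp [hp0], hi₁.const_mul ε⟩,
        ⟨(hr.const_mul ε).sub hφ, by simp [hp0, hφ0], (hi₂.const_mul ε).sub hφi⟩,
        fun z => ?_, rfl⟩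
      · rw [integral_sub (hi₂.const_mul ε) hφi, integral_const_mul, integral_const_mul] at this
        simp only [CompactlySupportedContinuousMap.coe_neg, Pi.neg_apply, integral_neg] at this
        linarith
      · have := hg z
        simp only [CompactlySupportedContinuousMap.coe_neg, Pi.neg_apply]
        unfold transportWeight at *
        linarith
  · rw [Jp, lintegral_withDensity_one_div_transportWeight hp m hcont.measurable]
    exact lintegral_div_le_of_forall_integral_le m hw (isCompact_transportWeight_le hp) hcont hw0
      (fun z => by positivity) (norm_sub_rpow_eq_zero hp) hcost

/-- Integrals against the restricted marginal of a function vanishing at the origin. -/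
lemma integral_map_restrict_compl_zero {γ : Measure (Euc d × Euc d)} {μ : Measure (Euc d)}
    {π : Euc d × Euc d → Euc d} (hπ : Measurable π) (hγ : (γ.map π).restrict {0}ᶜ = μ)
    {φ : Euc d → ℝ} (hφ : Measurable φ) (hφ0 : φ 0 = 0) (hφi : Integrable φ μ) :
    Integrable (fun z => φ (π z)) γ ∧ ∫ x, φ x ∂μ = ∫ z, φ (π z) ∂γ := by
  subst hγ
  have hsupp : Function.support φ ⊆ {0}ᶜ := by
    intro x hx hx0
    exact hx (by rw [mem_singleton_iff.1 hx0, hφ0])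
  have hφi' : Integrable φ (γ.map π) := (integrableOn_iff_integrable_of_support_subset hsupp).1 hφi
  refine ⟨hφi'.comp_measurable hπ, ?_⟩
  rw [setIntegral_eq_integral_of_forall_compl_eq_zero
    (fun x hx => Function.notMem_support.1 fun h => hx (hsupp h)),
    integral_map hπ.aemeasurable hφ.aestronglyMeasurable]

lemma AdmPair.integral_add_le {p : ℝ} (hp : 1 ≤ p) {φ ψ : Euc d → ℝ}
    (h : AdmPair p μ₁ μ₂ φ ψ) {γ : Measure (Euc d × Euc d)} (hγ : γ ∈ AdmPlan μ₁ μ₂)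
    (hJ : Jp p γ ≠ ⊤) : ∫ x, φ x ∂μ₁ + ∫ y, ψ y ∂μ₂ ≤ (Jp p γ).toReal := by
  obtain ⟨hφi, hψi, hφ, hψ, hφ0, hψ0, hle⟩ := h
  obtain ⟨-, hγ₁, hγ₂⟩ := hγ
  obtain ⟨hi₁, he₁⟩ := integral_map_restrict_compl_zero measurable_fst hγ₁ hφ.measurable hφ0 hφi
  obtain ⟨hi₂, he₂⟩ := integral_map_restrict_compl_zero measurable_snd hγ₂ hψ.measurable hψ0 hψi
  have hcont : Continuous fun z : Euc d × Euc d => ‖z.1 - z.2‖ ^ p :=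
    (continuous_norm_rpow hp).comp (continuous_fst.sub continuous_snd)
  have hnonneg : 0 ≤ᵐ[γ] fun z : Euc d × Euc d => ‖z.1 - z.2‖ ^ p := ae_of_all _ fun z => by
    simp only [Pi.zero_apply]
    positivity
  have hci : Integrable (fun z : Euc d × Euc d => ‖z.1 - z.2‖ ^ p) γ :=
    ⟨hcont.aestronglyMeasurable, (hasFiniteIntegral_iff_ofReal hnonneg).2 hJ.lt_top⟩
  rw [he₁, he₂, ← integral_add hi₁ hi₂, Jp,
    ← integral_eq_lintegral_of_nonneg_ae hnonneg hcont.aestronglyMeasurable]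
  exact integral_mono (hi₁.add hi₂) hci fun z => hle z.1 z.2

end Marginals

/-- Lemma 3.7 (duality): `d_{𝕃_p}(μ₁,μ₂)^p` equals the supremum of
`∫ φ dμ₁ + ∫ ψ dμ₂` over all pairs `(φ,ψ) ∈ Adm^p`. -/
theorem dLp_duality
    {d : ℕ} (p : ℝ) (hp1 : 1 ≤ p) (hp2 : p ≤ 2)
    (μ₁ μ₂ : Measure (Euc d)) (h₁ : IsMp p μ₁) (h₂ : IsMp p μ₂) :
    dLp p μ₁ μ₂ ^ p =
      sSup {t : ℝ | ∃ φ ψ : Euc d → ℝ, AdmPair p μ₁ μ₂ φ ψ ∧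
        t = (∫ x, φ x ∂μ₁) + ∫ y, ψ y ∂μ₂} := by
  have hdual : dLp p μ₁ μ₂ ^ p = (dLpPow p μ₁ μ₂).toReal := by
    rw [dLp, one_div, Real.rpow_inv_rpow ENNReal.toReal_nonneg (by linarith)]
  obtain ⟨γ₀, hγ₀, hJ₀⟩ := exists_admPlan_Jp_le hp1 h₁ h₂
  have hinf : dLpPow p μ₁ μ₂ ≤ Jp p γ₀ := iInf₂_le γ₀ hγ₀
  have htop : dLpPow p μ₁ μ₂ ≠ ⊤ := ne_top_of_le_ne_top ENNReal.ofReal_ne_top (hinf.trans hJ₀)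
  set S := {t : ℝ | ∃ φ ψ : Euc d → ℝ, AdmPair p μ₁ μ₂ φ ψ ∧
    t = (∫ x, φ x ∂μ₁) + ∫ y, ψ y ∂μ₂} with hS
  have hweak : ∀ t ∈ S, t ≤ (dLpPow p μ₁ μ₂).toReal := by
    rintro t ⟨φ, ψ, hpair, rfl⟩
    refine (ENNReal.ofReal_le_iff_le_toReal htop).1 (le_iInf₂ fun γ hγ => ?_)
    by_cases hJ : Jp p γ = ⊤
    · simp [hJ]
    · exact ENNReal.ofReal_le_of_le_toReal (hpair.integral_add_le hp1 hγ hJ)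
  have hzero : (0 : ℝ) ∈ S := ⟨fun _ => 0, fun _ => 0,
    ⟨integrable_zero _ _ _, integrable_zero _ _ _, upperSemicontinuous_const,
      upperSemicontinuous_const, rfl, rfl, fun x y => by simp only [add_zero]; positivity⟩,
    by simp⟩
  have hbdd : BddAbove S := ⟨_, hweak⟩
  rw [hdual]
  refine le_antisymm ?_ (csSup_le ⟨0, hzero⟩ hweak)
  refine ENNReal.toReal_le_of_le_ofReal (le_csSup hbdd hzero) ((hinf.trans hJ₀).trans ?_)
  refine ENNReal.ofReal_le_ofReal (neg_le.1 (le_csInf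
    ⟨0, zero_mem_dualMajorants fun z => neg_nonpos.2 (by positivity)⟩ ?_))
  rintro s ⟨φ, ψ, ⟨hφ, hφ0, hφi⟩, ⟨hψ, hψ0, hψi⟩, hle, rfl⟩
  refine neg_le.1 (le_csSup hbdd ⟨fun x => -φ x, fun y => -ψ y,
    ⟨hφi.neg, hψi.neg, hφ.neg.upperSemicontinuous, hψ.neg.upperSemicontinuous,
      by simp [hφ0], by simp [hψ0], fun x y => ?_⟩, ?_⟩)
  · have := hle (x, y)
    dsimp only at this
    linarith
  · rw [integral_neg, integral_neg, neg_add]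
end
end

section
/- Let p ∈ [1,2]. For any μ, ν ∈ 𝕃_p(B₁), d_{𝕃_p}(μ,ν) ≤ 2^{(p−1)/p} d_TV(μ_p, ν_p)^{1/p}, where μ_p and ν_p are the measures with dμ_p = |x|^p dμ and dν_p = |x|^p dν and d_TV denotes the total variation distance. -/
open MeasureTheory Set Metric Filter
open scoped ENNReal NNReal

noncomputable section

variable {d : ℕ} {A B : Type*}

/-- Splitting `μ` and `ν` into a common part `κ`, left in place, and remainders `ρ` and `σ`, moved
from and to the origin, bounds the transport cost. -/
theorem dLpPow_add_le {p : ℝ} (hp : 0 < p) (κ ρ σ : Measure (Euc d))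
    (hρ : (κ + ρ) {0} = 0) (hσ : (κ + σ) {0} = 0) :
    dLpPow p (κ + ρ) (κ + σ) ≤
      ∫⁻ x, ENNReal.ofReal (‖x‖ ^ p) ∂ρ + ∫⁻ x, ENNReal.ofReal (‖x‖ ^ p) ∂σ := by
  have hdiag : Measurable fun x : Euc d => (x, x) := by fun_prop
  have hleft : Measurable fun x : Euc d => (x, (0 : Euc d)) := by fun_prop
  have hright : Measurable fun x : Euc d => ((0 : Euc d), x) := by fun_prop
  have hcost : Measurable fun q : Euc d × Euc d => ENNReal.ofReal (‖q.1 - q.2‖ ^ p) := by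
    fun_prop
  have hκ0 : κ {0} = 0 := by
    simp only [Measure.add_apply, add_eq_zero] at hρ; exact hρ.1
  have hρ0 : ρ {0} = 0 := by
    simp only [Measure.add_apply, add_eq_zero] at hρ; exact hρ.2
  have hσ0 : σ {0} = 0 := by
    simp only [Measure.add_apply, add_eq_zero] at hσ; exact hσ.2
  have hrestrict : ∀ m : Measure (Euc d), m {0} = 0 → m.restrict {0}ᶜ = m := fun m hm =>
    Measure.restrict_eq_self_of_ae_mem (by rw [ae_iff]; simpa using hm)
  have hconst : ∀ m : Measure (Euc d),
      (m.map fun _ => (0 : Euc d)).restrict {(0 : Euc d)}ᶜ = 0 := fun m => by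
    rw [Measure.restrict_eq_zero, Measure.map_apply measurable_const (by measurability)]
    simp
  have hplan : κ.map (fun x => (x, x)) + ρ.map (fun x => (x, (0 : Euc d)))
      + σ.map (fun x => ((0 : Euc d), x)) ∈ AdmPlan (κ + ρ) (κ + σ) := by
    refine ⟨?_, ?_, ?_⟩
    · have h0 : MeasurableSet {((0 : Euc d), (0 : Euc d))} := measurableSet_singleton _
      have e1 : (fun x : Euc d => (x, x)) ⁻¹' {(0, 0)} = {0} := by ext; simp
      have e2 : (fun x : Euc d => (x, (0 : Euc d))) ⁻¹' {(0, 0)} = {0} := by ext; simp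
      have e3 : (fun x : Euc d => ((0 : Euc d), x)) ⁻¹' {(0, 0)} = {0} := by ext; simp
      rw [Measure.add_apply, Measure.add_apply, Measure.map_apply hdiag h0,
        Measure.map_apply hleft h0, Measure.map_apply hright h0, e1, e2, e3, hκ0, hρ0, hσ0]
      simp
    · rw [Measure.map_add _ _ measurable_fst, Measure.map_add _ _ measurable_fst,
        Measure.map_map measurable_fst hdiag, Measure.map_map measurable_fst hleft,
        Measure.map_map measurable_fst hright, Measure.restrict_add, Measure.restrict_add]
      simp only [Function.comp_def, Measure.map_id', hconst, hrestrict _ hκ0, hrestrict _ hρ0,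
        add_zero]
    · rw [Measure.map_add _ _ measurable_snd, Measure.map_add _ _ measurable_snd,
        Measure.map_map measurable_snd hdiag, Measure.map_map measurable_snd hleft,
        Measure.map_map measurable_snd hright, Measure.restrict_add, Measure.restrict_add]
      simp only [Function.comp_def, Measure.map_id', hconst, hrestrict _ hκ0, hrestrict _ hσ0,
        add_zero]
  refine (iInf₂_le _ hplan).trans (le_of_eq ?_)
  rw [Jp, lintegral_add_measure, lintegral_add_measure, lintegral_map hcost hdiag,
    lintegral_map hcost hleft, lintegral_map hcost hright]
  simp [Real.zero_rpow hp.ne']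

/-- Finite measures `μ` and `ν` are a common part plus remainders whose total mass is at most the
total variation distance of `μ` and `ν`. -/
theorem exists_common_part_le_dTV {X : Type*} [MeasurableSpace X] (μ ν : Measure X)
    [IsFiniteMeasure μ] [IsFiniteMeasure ν] :
    ∃ κ ρ σ : Measure X, μ = κ + ρ ∧ ν = κ + σ ∧ ρ univ + σ univ ≤ dTV μ ν := by
  obtain ⟨s, hs⟩ := exists_isHahnDecomposition μ ν
  have hsm := hs.measurableSet
  have hle := hs.le_on
  have hge := hs.ge_on_compl
  refine ⟨μ.restrict s + ν.restrict sᶜ, μ.restrict sᶜ - ν.restrict sᶜ,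
    ν.restrict s - μ.restrict s, ?_, ?_, ?_⟩
  · rw [add_assoc, add_comm (ν.restrict sᶜ), Measure.sub_add_cancel_of_le hge,
      Measure.restrict_add_restrict_compl hsm]
  · rw [add_right_comm, add_comm (μ.restrict s), Measure.sub_add_cancel_of_le hle,
      Measure.restrict_add_restrict_compl hsm]
  · rw [Measure.sub_apply .univ hge, Measure.sub_apply .univ hle]
    simp only [Measure.restrict_apply_univ]
    exact add_le_add (le_iSup₂ (f := fun t (_ : MeasurableSet t) => μ t - ν t) sᶜ hsm.compl)
      (le_iSup₂ (f := fun t (_ : MeasurableSet t) => ν t - μ t) s hsm)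

theorem dTV_lt_top {X : Type*} [MeasurableSpace X] (μ ν : Measure X)
    [IsFiniteMeasure μ] [IsFiniteMeasure ν] : dTV μ ν < ⊤ := by
  refine ENNReal.add_lt_top.2 ⟨?_, ?_⟩
  · exact (iSup₂_le fun s _ => tsub_le_self.trans (measure_mono (subset_univ s))).trans_lt
      (measure_lt_top μ univ)
  · exact (iSup₂_le fun s _ => tsub_le_self.trans (measure_mono (subset_univ s))).trans_lt
      (measure_lt_top ν univ)

/-- The weight `|x|^p` turns a Lévy measure on the unit ball into a finite measure. -/
theorem IsLevyLpOn.isFiniteMeasure_withDensity {p : ℝ} (hp : 0 < p) {μ : Measure (Euc d)}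
    (hμ : IsLevyLpOn p (ball (0 : Euc d) 1) μ) :
    IsFiniteMeasure (μ.withDensity fun x => ENNReal.ofReal (‖x‖ ^ p)) := by
  refine MeasureTheory.isFiniteMeasure_withDensity (ne_of_lt ?_)
  refine lt_of_eq_of_lt (lintegral_congr_ae ?_) hμ.1.2
  have hball : ∀ᵐ x ∂μ, x ∈ ball (0 : Euc d) 1 := hμ.2
  filter_upwards [hball] with x hx
  rw [min_eq_right]
  exact Real.rpow_le_one (norm_nonneg x) (mem_ball_zero_iff.1 hx).le hp.le

/-- Weighted total variation controls the transport cost. -/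
theorem dLpPow_le_dTV_withDensity {p : ℝ} (hp : 0 < p) {μ ν : Measure (Euc d)}
    (hμ : IsLevyLpOn p (ball (0 : Euc d) 1) μ) (hν : IsLevyLpOn p (ball (0 : Euc d) 1) ν) :
    dLpPow p μ ν ≤ dTV (μ.withDensity fun x => ENNReal.ofReal (‖x‖ ^ p))
      (ν.withDensity fun x => ENNReal.ofReal (‖x‖ ^ p)) := by
  have := hμ.isFiniteMeasure_withDensity hp
  have := hν.isFiniteMeasure_withDensity hp
  set w : Euc d → ℝ≥0∞ := fun x => ENNReal.ofReal (‖x‖ ^ p)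
  have hwm : Measurable w := by fun_prop
  obtain ⟨κ, ρ, σ, h₁, h₂, hle⟩ :=
    exists_common_part_le_dTV (μ.withDensity w) (ν.withDensity w)
  have hinv : ∀ m : Measure (Euc d), m {0} = 0 →
      (m.withDensity w).withDensity w⁻¹ = m := fun m hm => by
    refine withDensity_inv_same hwm ?_ (.of_forall fun x => ENNReal.ofReal_ne_top)
    have hne : ∀ᵐ x ∂m, x ≠ 0 := by rw [ae_iff]; simpa using hm
    filter_upwards [hne] with x hx
    exact (ENNReal.ofReal_pos.2 (Real.rpow_pos_of_pos (norm_pos_iff.2 hx) p)).ne'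
  have hcost : ∀ m : Measure (Euc d), ∫⁻ x, w x ∂m.withDensity w⁻¹ ≤ m univ := fun m => by
    rw [lintegral_withDensity_eq_lintegral_mul _ hwm.inv hwm, ← lintegral_one]
    exact lintegral_mono fun x => ENNReal.inv_mul_le_one (w x)
  have hμ' : κ.withDensity w⁻¹ + ρ.withDensity w⁻¹ = μ := by
    rw [← withDensity_add_measure, ← h₁, hinv μ hμ.1.1]
  have hν' : κ.withDensity w⁻¹ + σ.withDensity w⁻¹ = ν := by
    rw [← withDensity_add_measure, ← h₂, hinv ν hν.1.1]
  have hsplit := dLpPow_add_le hp (κ.withDensity w⁻¹) (ρ.withDensity w⁻¹) (σ.withDensity w⁻¹)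
    (by rw [hμ', hμ.1.1]) (by rw [hν', hν.1.1])
  rw [hμ', hν'] at hsplit
  exact hsplit.trans ((add_le_add (hcost ρ) (hcost σ)).trans hle)

/-- Proposition 5.10 (ii): for `μ, ν ∈ 𝕃_p(B₁)`,
`d_{𝕃_p}(μ,ν) ≤ 2^{(p-1)/p} d_TV(μ_p,ν_p)^{1/p}` where `dμ_p = |x|^p dμ, dν_p = |x|^p dν`. -/
theorem dLp_le_weighted_tv
    {d : ℕ} (p : ℝ) (hp1 : 1 ≤ p) (hp2 : p ≤ 2)
    (μ ν : Measure (Euc d))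
    (hμ : IsLevyLpOn p (ball (0 : Euc d) 1) μ) (hν : IsLevyLpOn p (ball (0 : Euc d) 1) ν) :
    dLp p μ ν ≤ (2:ℝ) ^ ((p - 1) / p) *
      (dTV (μ.withDensity fun x => ENNReal.ofReal (‖x‖ ^ p))
           (ν.withDensity fun x => ENNReal.ofReal (‖x‖ ^ p))).toReal ^ (1 / p) := by
  have hp : 0 < p := by linarith
  have := hμ.isFiniteMeasure_withDensity hp
  have := hν.isFiniteMeasure_withDensity hp
  have hcost := ENNReal.toReal_mono (dTV_lt_top _ _).ne (dLpPow_le_dTV_withDensity hp hμ hν)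
  have hconst : (1 : ℝ) ≤ 2 ^ ((p - 1) / p) :=
    Real.one_le_rpow one_le_two (div_nonneg (by linarith) hp.le)
  exact (Real.rpow_le_rpow ENNReal.toReal_nonneg hcost (by positivity)).trans
    (le_mul_of_one_le_left (by positivity) hconst)
end
end

section
/- Let U be a separable Hilbert space, μ a positive Borel measure on U∖{0}, and ρ : U∖{0} → (0,∞) a Borel function with ∫_{U∖{0}} ρ(z)² dμ(z) ≤ C. Let {T_x}_{x∈𝒪} be a family of Borel measurable maps T_x : U → ℝ^d satisfying |T_x(z)| ≤ Cρ(z) and |T_x(z) − T_y(z)| ≤ Cρ(z)|x−y| for all z ∈ U∖{0} and x, y ∈ 𝒪. Then for each x the pushforward μ_x := (T_x)_# μ, restricted to ℝ^d∖{0}, belongs to M₂(ℝ^d), and d_{𝕃₂}(μ_x, μ_y)² ≤ ∫_{U∖{0}} |T_x(z) − T_y(z)|² dμ(z) ≤ C³|x−y|² for all x, y ∈ 𝒪. -/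
open MeasureTheory Set Metric Filter
open scoped ENNReal NNReal

noncomputable section

variable {d : ℕ} {A B : Type*}

lemma lintegral_norm_sq_le_of_ae_le {X E : Type*} [MeasurableSpace X] [NormedAddCommGroup E]
    {μ : Measure X} {ρ : X → ℝ} (hρ : Measurable ρ) {C : ℝ}
    (hρint : ∫⁻ z, ENNReal.ofReal (ρ z ^ 2) ∂μ ≤ ENNReal.ofReal C)
    {K : ℝ} {f : X → E} (hf : ∀ᵐ z ∂μ, ‖f z‖ ≤ K * ρ z) :
    ∫⁻ z, ENNReal.ofReal (‖f z‖ ^ 2) ∂μ ≤ ENNReal.ofReal (K ^ 2 * C) := by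
  calc ∫⁻ z, ENNReal.ofReal (‖f z‖ ^ 2) ∂μ
      ≤ ∫⁻ z, ENNReal.ofReal (K ^ 2) * ENNReal.ofReal (ρ z ^ 2) ∂μ := by
        refine lintegral_mono_ae (hf.mono fun z hz => ?_)
        rw [← ENNReal.ofReal_mul (sq_nonneg K), ← mul_pow]
        exact ENNReal.ofReal_le_ofReal (pow_le_pow_left₀ (norm_nonneg _) hz 2)
    _ = ENNReal.ofReal (K ^ 2) * ∫⁻ z, ENNReal.ofReal (ρ z ^ 2) ∂μ :=
        lintegral_const_mul _ (by fun_prop)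
    _ ≤ ENNReal.ofReal (K ^ 2) * ENNReal.ofReal C := by gcongr
    _ = ENNReal.ofReal (K ^ 2 * C) := (ENNReal.ofReal_mul (sq_nonneg K)).symm

lemma isMp_of_lintegral_lt_top {p : ℝ} {μ : Measure (Euc d)} (h0 : μ {0} = 0)
    (h : ∫⁻ z, ENNReal.ofReal (‖z‖ ^ p) ∂μ < ⊤) : IsMp p μ :=
  ⟨⟨h0, (lintegral_mono fun _ => ENNReal.ofReal_le_ofReal (min_le_right _ _)).trans_lt h⟩, h⟩

lemma restrict_map_prodMk_mem_admPlan {X : Type*} [MeasurableSpace X] (μ : Measure X)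
    {f g : X → Euc d} (hf : Measurable f) (hg : Measurable g) :
    (μ.map fun z => (f z, g z)).restrict {((0 : Euc d), (0 : Euc d))}ᶜ ∈
      AdmPlan ((μ.map f).restrict {0}ᶜ) ((μ.map g).restrict {0}ᶜ) := by
  have h0 : MeasurableSet ({((0 : Euc d), (0 : Euc d))}ᶜ : Set (Euc d × Euc d)) :=
    (measurableSet_singleton _).compl
  have h1 : MeasurableSet ({(0 : Euc d)}ᶜ : Set (Euc d)) := (measurableSet_singleton _).compl
  refine ⟨by simp [Measure.restrict_apply], ?_, ?_⟩
  · rw [Measure.restrict_map measurable_fst h1, Measure.restrict_restrict (measurable_fst h1),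
      inter_eq_left.mpr (by rintro q hq rfl; exact hq rfl), ← Measure.restrict_map measurable_fst h1,
      Measure.map_map measurable_fst (hf.prodMk hg)]
    rfl
  · rw [Measure.restrict_map measurable_snd h1, Measure.restrict_restrict (measurable_snd h1),
      inter_eq_left.mpr (by rintro q hq rfl; exact hq rfl), ← Measure.restrict_map measurable_snd h1,
      Measure.map_map measurable_snd (hf.prodMk hg)]
    rfl

lemma dLpPow_map_le {X : Type*} [MeasurableSpace X] (μ : Measure X) (p : ℝ)
    {f g : X → Euc d} (hf : Measurable f) (hg : Measurable g) :
    dLpPow p ((μ.map f).restrict {0}ᶜ) ((μ.map g).restrict {0}ᶜ) ≤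
      ∫⁻ z, ENNReal.ofReal (‖f z - g z‖ ^ p) ∂μ := by
  refine (iInf₂_le _ (restrict_map_prodMk_mem_admPlan μ hf hg)).trans ?_
  refine (lintegral_mono' Measure.restrict_le_self le_rfl).trans_eq ?_
  exact lintegral_map (by fun_prop) (hf.prodMk hg)

lemma ofReal_dLp_two_sq_le (μ ν : Measure (Euc d)) :
    ENNReal.ofReal (dLp 2 μ ν ^ 2) ≤ dLpPow 2 μ ν := by
  rw [dLp, ← Real.sqrt_eq_rpow, Real.sq_sqrt ENNReal.toReal_nonneg]
  exact ENNReal.ofReal_toReal_le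

/-- Example 5.12 (Lévy–Itô case): for push-forwards `μ_x = (T_x)_# μ` of a reference Lévy
measure `μ` on a separable Hilbert space `U` under maps with `|T_x(z)| ≤ Cρ(z)` and
`|T_x(z) - T_y(z)| ≤ Cρ(z)|x-y|`, where `∫ ρ² dμ ≤ C`, the measures `μ_x` (restricted to
`ℝ^d ∖ {0}`) lie in `M₂(ℝ^d)` and
`d_{𝕃₂}(μ_x,μ_y)² ≤ ∫ |T_x - T_y|² dμ ≤ C³ |x-y|²`. -/
theorem levy_ito_transport_estimate
    {d : ℕ} {U : Type*} [NormedAddCommGroup U] [InnerProductSpace ℝ U] [CompleteSpace U]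
    [SecondCountableTopology U] [MeasurableSpace U] [BorelSpace U]
    (μ : Measure U) (hμ0 : μ {0} = 0)
    (ρ : U → ℝ) (hρmeas : Measurable ρ) (hρpos : ∀ z : U, z ≠ 0 → 0 < ρ z)
    (C : ℝ) (hC : 0 ≤ C)
    (hρint : ∫⁻ z, ENNReal.ofReal (ρ z ^ 2) ∂μ ≤ ENNReal.ofReal C)
    (O : Set (Euc d)) (T : Euc d → U → Euc d)
    (hTmeas : ∀ x ∈ O, Measurable (T x))
    (hTbound : ∀ x ∈ O, ∀ z : U, z ≠ 0 → ‖T x z‖ ≤ C * ρ z)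
    (hTlip : ∀ x ∈ O, ∀ y ∈ O, ∀ z : U, z ≠ 0 → ‖T x z - T y z‖ ≤ C * ρ z * ‖x - y‖) :
    ∀ x ∈ O, ∀ y ∈ O,
      IsMp 2 ((μ.map (T x)).restrict {(0 : Euc d)}ᶜ) ∧
      ENNReal.ofReal
          (dLp 2 ((μ.map (T x)).restrict {(0 : Euc d)}ᶜ)
               ((μ.map (T y)).restrict {(0 : Euc d)}ᶜ) ^ 2) ≤
        ∫⁻ z, ENNReal.ofReal (‖T x z - T y z‖ ^ 2) ∂μ ∧
      ∫⁻ z, ENNReal.ofReal (‖T x z - T y z‖ ^ 2) ∂μ ≤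
        ENNReal.ofReal (C ^ 3 * ‖x - y‖ ^ 2) := by
  intro x hx y hy
  have hne : ∀ᵐ z ∂μ, z ≠ 0 := by simpa [ae_iff] using hμ0
  refine ⟨isMp_of_lintegral_lt_top (by simp [Measure.restrict_apply]) ?_, ?_, ?_⟩
  · refine (lintegral_mono' Measure.restrict_le_self le_rfl).trans_lt ?_
    rw [lintegral_map (by fun_prop) (hTmeas x hx)]
    simp only [Real.rpow_two]
    exact (lintegral_norm_sq_le_of_ae_le hρmeas hρint
      (hne.mono (hTbound x hx))).trans_lt ENNReal.ofReal_lt_top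
  · simpa only [Real.rpow_two] using
      (ofReal_dLp_two_sq_le _ _).trans (dLpPow_map_le μ 2 (hTmeas x hx) (hTmeas y hy))
  · refine (lintegral_norm_sq_le_of_ae_le (K := C * ‖x - y‖) hρmeas hρint
      (hne.mono fun z hz => ?_)).trans_eq (congrArg _ (by ring))
    exact (hTlip x hx y hy z hz).trans_eq (by ring)
end
end

section
/- Let Ω ⊂ ℝ^d be open, Γ ⊂ Ω̄ compact, and let c : Ω̄×Ω̄ → ℝ be a continuous cost with c(x,y) = c(y,x), c(x,x) = 0, and c(x,y) > 0 for x ≠ y, for which there exists a measurable map P : Ω̄ → Γ with c(x,P(x)) = inf_{y∈Γ} c(x,y). Let μ, ν ∈ M_c(Ω̄) and γ ∈ Adm_Γ(μ,ν). Then γ is a minimizer of J_c(γ) := ∫_{Ω̄×Ω̄} c(x,y) dγ(x,y) over Adm_Γ(μ,ν) if and only if γ is concentrated on the set 𝒦 := { (x,y) ∈ Ω̄×Ω̄ : c(x,y) ≤ c(x,Γ) + c(y,Γ) } and spt(γ) ∪ (Γ×Γ) is a c̃-cyclically monotone set. -/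
open MeasureTheory Set Metric Filter
open scoped ENNReal NNReal

noncomputable section

variable {d : ℕ} {A B : Type*}

/-- `c(x,Γ) = inf_{y ∈ Γ} c(x,y)`. -/
def cInfOn {d : ℕ} (c : Euc d → Euc d → ℝ) (Γ : Set (Euc d)) (x : Euc d) : ℝ :=
  ⨅ y : Γ, c x y

/-- The auxiliary cost `c̃(x,y) = min { c(x,y), c(x,Γ) + c(y,Γ) }`. -/
def ctilde {d : ℕ} (c : Euc d → Euc d → ℝ) (Γ : Set (Euc d)) (x y : Euc d) : ℝ :=
  min (c x y) (cInfOn c Γ x + cInfOn c Γ y)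

/-- `c`-cyclical monotonicity of a set of pairs. -/
def CyclicallyMonotone {d : ℕ} (ct : Euc d → Euc d → ℝ) (S : Set (Euc d × Euc d)) : Prop :=
  ∀ (n : ℕ) (q : Fin n → Euc d × Euc d), (∀ i, q i ∈ S) → ∀ σ : Equiv.Perm (Fin n),
    ∑ i, ct (q i).1 (q i).2 ≤ ∑ i, ct (q i).1 (q (σ i)).2

/-- The (topological) support of a measure. -/
def msupport {X : Type*} [TopologicalSpace X] [MeasurableSpace X] (γ : Measure X) : Set X :=
  {x | ∀ U ∈ nhds x, γ U ≠ 0}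

/-- `μ ∈ M_c(Ω̄)`: a positive Borel measure on `Ω̄ ∖ Γ` with `∫ c(x,Γ) dμ < ∞` and
`μ({d(x,Γ) > r}) < ∞` for all `r > 0`. -/
def McMem {d : ℕ} (c : Euc d → Euc d → ℝ) (Ω Γ : Set (Euc d)) (μ : Measure (Euc d)) : Prop :=
  μ (closure Ω)ᶜ = 0 ∧ μ Γ = 0 ∧
  (∫⁻ x, ENNReal.ofReal (cInfOn c Γ x) ∂μ < ⊤) ∧
  ∀ r : ℝ, 0 < r → μ {x : Euc d | r < Metric.infDist x Γ} < ⊤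

/-- Admissible couplings for the transport problem with boundary `Γ`. -/
def AdmGamma {d : ℕ} (Ω Γ : Set (Euc d)) (μ ν : Measure (Euc d)) :
    Set (Measure (Euc d × Euc d)) :=
  {γ | γ (closure Ω ×ˢ closure Ω)ᶜ = 0 ∧ γ (Γ ×ˢ Γ) = 0 ∧
       (γ.map Prod.fst).restrict Γᶜ = μ ∧ (γ.map Prod.snd).restrict Γᶜ = ν}

/-- The cost functional `J_c(γ) = ∫ c(x,y) dγ(x,y)`. -/
def Jc {d : ℕ} (c : Euc d → Euc d → ℝ) (γ : Measure (Euc d × Euc d)) : ℝ≥0∞ :=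
  ∫⁻ q, ENNReal.ofReal (c q.1 q.2) ∂γ

/-- The set `𝒦 = { (x,y) ∈ Ω̄ × Ω̄ : c(x,y) ≤ c(x,Γ) + c(y,Γ) }`. -/
def Kset {d : ℕ} (c : Euc d → Euc d → ℝ) (Ω Γ : Set (Euc d)) : Set (Euc d × Euc d) :=
  {q | q.1 ∈ closure Ω ∧ q.2 ∈ closure Ω ∧
       c q.1 q.2 ≤ cInfOn c Γ q.1 + cInfOn c Γ q.2}

/-- The cost of rerouting along a chain `q` of pairs, started at `x`: the point `x` is sent to
`(q 0).2`, each `(q i).1` is sent to `(q (i + 1)).2`, and the original costs are removed. -/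
def chainCost (f : Euc d → Euc d → ℝ) {n : ℕ} (q : Fin (n + 1) → Euc d × Euc d) (x : Euc d) : ℝ :=
  f x (q 0).2 + ∑ i : Fin n, f (q i.castSucc).1 (q i.succ).2 - ∑ i, f (q i).1 (q i).2

lemma chainCost_cons (f : Euc d → Euc d → ℝ) {n : ℕ} (q : Fin (n + 1) → Euc d × Euc d)
    (p : Euc d × Euc d) (x : Euc d) :
    chainCost f (Fin.cons p q : Fin (n + 2) → Euc d × Euc d) x =
      chainCost f q p.1 + f x p.2 - f p.1 p.2 := by
  simp only [chainCost]
  rw [Fin.sum_univ_succ (n := n), Fin.sum_univ_succ (n := n + 1)]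
  simp only [Fin.cons_zero, Fin.cons_succ, Fin.castSucc_zero, ← Fin.succ_castSucc]
  ring

lemma CyclicallyMonotone.chainCost_last_nonneg {f : Euc d → Euc d → ℝ} {S : Set (Euc d × Euc d)}
    (h : CyclicallyMonotone f S) {n : ℕ} {q : Fin (n + 1) → Euc d × Euc d} (hq : ∀ i, q i ∈ S) :
    0 ≤ chainCost f q (q (Fin.last n)).1 := by
  have := h (n + 1) q hq (finRotate (n + 1))
  rw [Fin.sum_univ_castSucc (f := fun i => f (q i).1 (q (finRotate (n + 1) i)).2)] at this
  rw [finRotate_last] at this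
  simp only [finRotate_apply, Fin.coeSucc_eq_succ] at this
  simp only [chainCost]
  linarith

lemma measurable_indicator_iInf {ι : Type*} {s : Set (Euc d)} (hs : MeasurableSet s)
    {F : ι → Euc d → ℝ} (hF : ∀ i, Continuous (F i))
    (hbdd : ∀ x ∈ s, BddBelow (range fun i => F i x)) :
    Measurable (s.indicator fun x => ⨅ i, F i x) := by
  refine measurable_of_restrict_of_restrict_compl hs ?_ ?_
  · have : s.domRestrict (s.indicator fun x => ⨅ i, F i x) = fun x : s => ⨅ i, F i x := by
      ext x
      simp
    rw [this]
    exact (upperSemicontinuous_ciInf (f := fun i (x : s) => F i x) (fun x => hbdd x x.2)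
      fun i => ((hF i).comp continuous_subtype_val).upperSemicontinuous).measurable
  · have : sᶜ.domRestrict (s.indicator fun x => ⨅ i, F i x) = fun _ => 0 := by
      ext x
      exact indicator_of_notMem x.2 _
    rw [this]
    exact measurable_const

/-- Rockafellar's construction: a cyclically monotone set is contained in the contact set of a pair
of potentials, here defined on the two projections of the set. -/
lemma CyclicallyMonotone.exists_potentials {f : Euc d → Euc d → ℝ}
    (hf : Continuous fun q : Euc d × Euc d => f q.1 q.2) {S : Set (Euc d × Euc d)}
    (h : CyclicallyMonotone f S) {a b : Euc d} (hab : (a, b) ∈ S)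
    (hA : MeasurableSet (Prod.fst '' S)) (hB : MeasurableSet (Prod.snd '' S)) :
    ∃ φ ψ : Euc d → ℝ, Measurable φ ∧ Measurable ψ ∧ φ a = 0 ∧
      (∀ x ∈ Prod.fst '' S, ∀ y ∈ Prod.snd '' S, φ x + ψ y ≤ f x y) ∧
      ∀ q ∈ S, φ q.1 + ψ q.2 = f q.1 q.2 := by
  let I := {p : Σ n : ℕ, (Fin (n + 1) → Euc d × Euc d) //
    (∀ i, p.2 i ∈ S) ∧ p.2 (Fin.last _) = (a, b)}
  let F : I → Euc d → ℝ := fun p x => chainCost f p.1.2 x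
  have cons : ∀ (i : I) (q : Euc d × Euc d), q ∈ S → ∃ j : I, ∀ x,
      F j x = F i q.1 + f x q.2 - f q.1 q.2 := by
    intro i q hq
    refine ⟨⟨⟨i.1.1 + 1, Fin.cons q i.1.2⟩, ?_, ?_⟩, fun x => chainCost_cons f i.1.2 q x⟩
    · exact fun k => Fin.cases hq (fun k => i.2.1 k) k
    · exact i.2.2
  have Fa : ∀ i : I, 0 ≤ F i a := by
    intro i
    have := h.chainCost_last_nonneg i.2.1
    rwa [i.2.2] at this
  let i₀ : I := ⟨⟨0, fun _ => (a, b)⟩, fun _ => hab, rfl⟩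
  have Fi₀ : F i₀ a = 0 := by simp [F, i₀, chainCost]
  have lower : ∀ q ∈ S, ∀ i : I, f q.1 q.2 - f a q.2 ≤ F i q.1 := by
    intro q hq i
    obtain ⟨j, hj⟩ := cons i q hq
    have := Fa j
    rw [hj] at this
    linarith
  have Fbdd : ∀ x ∈ Prod.fst '' S, BddBelow (range fun i => F i x) := by
    rintro _ ⟨q, hq, rfl⟩
    exact ⟨_, by rintro _ ⟨i, rfl⟩; exact lower q hq i⟩
  have Fcont : ∀ i, Continuous (F i) := by
    intro i
    have : Continuous fun x => f x (i.1.2 0).2 :=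
      hf.comp (continuous_id.prodMk continuous_const)
    simp only [F, chainCost]
    fun_prop
  set φ : Euc d → ℝ := (Prod.fst '' S).indicator fun x => ⨅ i, F i x with hφ
  have φ_eq : ∀ x ∈ Prod.fst '' S, φ x = ⨅ i, F i x := fun x hx => indicator_of_mem hx _
  have : Nonempty I := ⟨i₀⟩
  have step : ∀ q ∈ S, ∀ x ∈ Prod.fst '' S, φ x ≤ φ q.1 + f x q.2 - f q.1 q.2 := by
    intro q hq x hx
    have : φ x - f x q.2 + f q.1 q.2 ≤ φ q.1 := by
      rw [φ_eq q.1 ⟨q, hq, rfl⟩]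
      refine le_ciInf fun i => ?_
      obtain ⟨j, hj⟩ := cons i q hq
      have h1 := ciInf_le (Fbdd x hx) j
      rw [← φ_eq x hx, hj] at h1
      linarith
    linarith
  have : Nonempty (Prod.fst '' S) := ⟨⟨a, (a, b), hab, rfl⟩⟩
  let G : (Prod.fst '' S : Set (Euc d)) → Euc d → ℝ := fun x y => f x y - φ x
  have Gcont : ∀ i, Continuous (G i) := fun i =>
    (hf.comp (continuous_const.prodMk continuous_id)).sub continuous_const
  have Glow : ∀ q ∈ S, ∀ x, f q.1 q.2 - φ q.1 ≤ G x q.2 := by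
    intro q hq x
    have := step q hq x x.2
    simp only [G]
    linarith
  have Gbdd : ∀ y ∈ Prod.snd '' S, BddBelow (range fun i => G i y) := by
    rintro _ ⟨q, hq, rfl⟩
    exact ⟨_, by rintro _ ⟨i, rfl⟩; exact Glow q hq i⟩
  refine ⟨φ, (Prod.snd '' S).indicator fun y => ⨅ x, G x y,
    measurable_indicator_iInf hA Fcont Fbdd, measurable_indicator_iInf hB Gcont Gbdd, ?_, ?_, ?_⟩
  · rw [φ_eq a ⟨_, hab, rfl⟩]
    exact le_antisymm ((ciInf_le (Fbdd a ⟨_, hab, rfl⟩) i₀).trans Fi₀.le) (le_ciInf Fa)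
  · intro x hx y hy
    rw [indicator_of_mem hy]
    have := ciInf_le (Gbdd y hy) ⟨x, hx⟩
    simp only [G] at this ⊢
    linarith
  · intro q hq
    have hy : q.2 ∈ Prod.snd '' S := ⟨q, hq, rfl⟩
    rw [indicator_of_mem hy]
    have h1 := ciInf_le (Gbdd q.2 hy) ⟨q.1, q, hq, rfl⟩
    have h2 := le_ciInf (Glow q hq)
    simp only [G] at h1 h2 ⊢
    linarith

/-- If no plan with the same marginals has a smaller cost than `γ`, then the support of `γ` is
cyclically monotone. -/
lemma cyclicallyMonotone_msupport {f : Euc d → Euc d → ℝ}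
    (hf : Continuous fun q : Euc d × Euc d => f q.1 q.2) (hf0 : ∀ x y, 0 ≤ f x y)
    (γ : Measure (Euc d × Euc d)) [SigmaFinite γ] (hfin : Jc f γ ≠ ⊤)
    (hmin : ∀ γ' : Measure (Euc d × Euc d), γ'.map Prod.fst = γ.map Prod.fst →
      γ'.map Prod.snd = γ.map Prod.snd → Jc f γ ≤ Jc f γ') :
    CyclicallyMonotone f (msupport γ) := by
  intro n q hq σ
  by_contra! hlt
  have hn : 0 < n := by
    rcases Nat.eq_zero_or_pos n with rfl | h
    · simp at hlt
    · exact h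
  have hn' : (0 : ℝ) < n := by exact_mod_cast hn
  obtain ⟨ε, hε, hgap⟩ : ∃ ε : ℝ, 0 < ε ∧
      ∑ i, (f (q i).1 (q (σ i)).2 + ε) < ∑ i, (f (q i).1 (q i).2 - ε) := by
    refine ⟨(∑ i, f (q i).1 (q i).2 - ∑ i, f (q i).1 (q (σ i)).2) / (4 * n), by
      apply div_pos <;> linarith, ?_⟩
    simp only [Finset.sum_add_distrib, Finset.sum_sub_distrib, Finset.sum_const, Finset.card_univ,
      Fintype.card_fin, nsmul_eq_mul]
    field_simp
    linarith
  obtain ⟨r, hr, hfr⟩ : ∃ r > 0, ∀ i j, ∀ z ∈ ball (q i).1 r ×ˢ ball (q j).2 r,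
      |f z.1 z.2 - f (q i).1 (q j).2| < ε := by
    have key : ∀ i j, ∃ r > 0, ∀ z : Euc d × Euc d,
        dist z ((q i).1, (q j).2) < r → |f z.1 z.2 - f (q i).1 (q j).2| < ε := by
      intro i j
      obtain ⟨r, hr, h⟩ := Metric.continuous_iff.1 hf ((q i).1, (q j).2) ε hε
      exact ⟨r, hr, fun z hz => by simpa [Real.dist_eq] using h z hz⟩
    choose r hr h using key
    have : ∀ᶠ s in nhdsWithin (0 : ℝ) (Ioi 0), ∀ i j, s < r i j := by
      simp only [Filter.eventually_all]
      exact fun i j => nhdsWithin_le_nhds (Iio_mem_nhds (hr i j))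
    obtain ⟨s, hs, hs0⟩ := (this.and self_mem_nhdsWithin).exists
    refine ⟨s, hs0, fun i j z hz => h i j z ?_⟩
    rw [ball_prod_same] at hz
    exact (mem_ball.1 hz).trans (hs i j)
  have hW : ∀ i, ∃ W, MeasurableSet W ∧ W ⊆ ball (q i).1 r ×ˢ ball (q i).2 r ∧
      0 < γ W ∧ γ W < ⊤ := by
    intro i
    refine Measure.exists_subset_measure_lt_top (measurableSet_ball.prod measurableSet_ball) ?_
    exact pos_iff_ne_zero.2 (hq i _ (prod_mem_nhds (ball_mem_nhds _ hr) (ball_mem_nhds _ hr)))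
  choose W hWm hWsub hWpos hWfin using hW
  let p : Fin n → Measure (Euc d × Euc d) := fun i => ProbabilityTheory.cond γ (W i)
  have hp : ∀ i, IsProbabilityMeasure (p i) := fun i =>
    ProbabilityTheory.cond_isProbabilityMeasure_of_finite (hWpos i).ne' (hWfin i).ne
  have hpW : ∀ i, ∀ᵐ z ∂(p i), z ∈ W i := fun i =>
    Measure.ae_smul_measure (ae_restrict_mem (hWm i)) _
  have : Nonempty (Fin n) := ⟨⟨0, hn⟩⟩
  obtain ⟨i₁, -, hi₁⟩ := Finset.exists_min_image Finset.univ (fun i => γ (W i)) Finset.univ_nonempty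
  let κ : ℝ≥0∞ := (n : ℝ≥0∞)⁻¹ * γ (W i₁)
  have hnE : (n : ℝ≥0∞) ≠ 0 := by exact_mod_cast hn.ne'
  have hκ0 : κ ≠ 0 := mul_ne_zero (by simp) (hWpos i₁).ne'
  have hκt : κ ≠ ⊤ := ENNReal.mul_ne_top (by simpa using hn.ne') (hWfin i₁).ne
  let lam : Measure (Euc d × Euc d) := ∑ i, κ • p i
  have : ∀ i, IsFiniteMeasure (κ • p i) := fun i => Measure.smul_finite _ hκt
  have hlam : lam ≤ γ := by
    have h1 : ∀ i, κ • p i ≤ (n : ℝ≥0∞)⁻¹ • γ := by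
      intro i
      have h2 : κ * (γ (W i))⁻¹ ≤ (n : ℝ≥0∞)⁻¹ := by
        rw [mul_assoc]
        refine mul_le_of_le_one_right' ?_
        rw [← ENNReal.mul_inv_cancel (hWpos i).ne' (hWfin i).ne]
        exact mul_le_mul_left (hi₁ i (Finset.mem_univ i)) _
      refine Measure.le_iff.2 fun s hs => ?_
      simp only [p, ProbabilityTheory.cond, Measure.smul_apply, smul_eq_mul, ← mul_assoc]
      gcongr
      exact Measure.restrict_le_self
    calc lam ≤ ∑ _i : Fin n, (n : ℝ≥0∞)⁻¹ • γ := Finset.sum_le_sum fun i _ => h1 i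
      _ = γ := by
        rw [Finset.sum_const, Finset.card_univ, Fintype.card_fin, ← Nat.cast_smul_eq_nsmul ℝ≥0∞,
          smul_smul, ENNReal.mul_inv_cancel hnE (by simp), one_smul]
  let ρ := γ - lam
  have hγ : ρ + lam = γ := Measure.sub_add_cancel_of_le hlam
  let η : Fin n → Measure (Euc d × Euc d) := fun i =>
    ((p i).map Prod.fst).prod ((p (σ i)).map Prod.snd)
  have : ∀ i, IsProbabilityMeasure ((p i).map Prod.fst) := fun i =>
    Measure.isProbabilityMeasure_map measurable_fst.aemeasurable
  have : ∀ i, IsProbabilityMeasure ((p i).map Prod.snd) := fun i =>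
    Measure.isProbabilityMeasure_map measurable_snd.aemeasurable
  have hle := hmin (ρ + ∑ i, κ • η i) (by
      conv_rhs => rw [← hγ]
      rw [Measure.map_add _ _ measurable_fst, Measure.map_add _ _ measurable_fst]
      congr 1
      simp only [lam]
      rw [Measure.map_finset_sum measurable_fst.aemeasurable,
        Measure.map_finset_sum measurable_fst.aemeasurable]
      simp [η, Measure.map_smul, Measure.map_fst_prod]) (by
      conv_rhs => rw [← hγ]
      rw [Measure.map_add _ _ measurable_snd, Measure.map_add _ _ measurable_snd]
      congr 1
      simp only [lam]
      rw [Measure.map_finset_sum measurable_snd.aemeasurable,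
        Measure.map_finset_sum measurable_snd.aemeasurable]
      simp only [η, Measure.map_smul, Measure.map_snd_prod, measure_univ, one_smul]
      exact Equiv.sum_comp σ fun i => κ • (p i).map Prod.snd)
  rw [← hγ] at hle hfin
  simp only [Jc, lam, lintegral_add_measure, lintegral_finsetSum_measure, lintegral_smul_measure,
    smul_eq_mul, ← Finset.mul_sum] at hle hfin
  have hle' := (ENNReal.mul_le_mul_iff_right hκ0 hκt).1
    ((ENNReal.add_le_add_iff_left (ENNReal.add_ne_top.1 hfin).1).1 hle)
  have hlow : ENNReal.ofReal (∑ i, (f (q i).1 (q i).2 - ε)) ≤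
      ∑ i, ∫⁻ z, ENNReal.ofReal (f z.1 z.2) ∂(p i) := by
    refine (Finset.le_sum_of_subadditive _ ENNReal.ofReal_zero.le (fun _ _ => ENNReal.ofReal_add_le)
      _ _).trans (Finset.sum_le_sum fun i _ => ?_)
    calc _ = ∫⁻ _, ENNReal.ofReal (f (q i).1 (q i).2 - ε) ∂(p i) := by simp
      _ ≤ _ := by
        refine lintegral_mono_ae ?_
        filter_upwards [hpW i] with z hz
        have := abs_lt.1 (hfr i i z (hWsub i hz))
        exact ENNReal.ofReal_le_ofReal (by linarith)
  have hupp : ∑ i, ∫⁻ z, ENNReal.ofReal (f z.1 z.2) ∂(η i) ≤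
      ENNReal.ofReal (∑ i, (f (q i).1 (q (σ i)).2 + ε)) := by
    rw [ENNReal.ofReal_sum_of_nonneg fun i _ => add_nonneg (hf0 _ _) hε.le]
    refine Finset.sum_le_sum fun i _ => ?_
    have h1 : ∀ᵐ x ∂((p i).map Prod.fst), x ∈ ball (q i).1 r := by
      refine (ae_map_iff measurable_fst.aemeasurable measurableSet_ball).2 ?_
      filter_upwards [hpW i] with z hz using (hWsub i hz).1
    have h2 : ∀ᵐ y ∂((p (σ i)).map Prod.snd), y ∈ ball (q (σ i)).2 r := by
      refine (ae_map_iff measurable_snd.aemeasurable measurableSet_ball).2 ?_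
      filter_upwards [hpW (σ i)] with z hz using (hWsub (σ i) hz).2
    calc _ ≤ ∫⁻ _, ENNReal.ofReal (f (q i).1 (q (σ i)).2 + ε) ∂(η i) := by
          refine lintegral_mono_ae ?_
          filter_upwards [Measure.quasiMeasurePreserving_fst.ae h1,
            Measure.quasiMeasurePreserving_snd.ae h2] with z hz1 hz2
          have := abs_lt.1 (hfr i (σ i) z ⟨hz1, hz2⟩)
          exact ENNReal.ofReal_le_ofReal (by linarith)
      _ = _ := by simp [η]
  have hnn : 0 ≤ ∑ i, (f (q i).1 (q (σ i)).2 + ε) :=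
    Finset.sum_nonneg fun i _ => add_nonneg (hf0 _ _) hε.le
  have := (ENNReal.ofReal_le_ofReal_iff hnn).1 (hlow.trans (hle'.trans hupp))
  linarith

lemma cInfOn_eq_sInf (c : Euc d → Euc d → ℝ) (Γ : Set (Euc d)) (x : Euc d) :
    cInfOn c Γ x = sInf (c x '' Γ) := by
  rw [cInfOn, sInf_image']

lemma continuous_cInfOn {c : Euc d → Euc d → ℝ} (hc : Continuous fun q : Euc d × Euc d => c q.1 q.2)
    {Γ : Set (Euc d)} (hΓ : IsCompact Γ) : Continuous (cInfOn c Γ) := by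
  rw [show cInfOn c Γ = fun x => sInf (c x '' Γ) from funext (cInfOn_eq_sInf c Γ)]
  exact hΓ.continuous_sInf hc

lemma cInfOn_nonneg {c : Euc d → Euc d → ℝ} (hc0 : ∀ x y, 0 ≤ c x y) (Γ : Set (Euc d))
    (x : Euc d) : 0 ≤ cInfOn c Γ x :=
  Real.iInf_nonneg fun _ => hc0 _ _

lemma cInfOn_eq_zero {c : Euc d → Euc d → ℝ} (hc0 : ∀ x y, 0 ≤ c x y) {Γ : Set (Euc d)}
    {x : Euc d} (hx : x ∈ Γ) (hxx : c x x = 0) : cInfOn c Γ x = 0 := by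
  refine le_antisymm ?_ (cInfOn_nonneg hc0 Γ x)
  rw [← hxx]
  exact ciInf_le (f := fun y : Γ => c x y) ⟨0, by rintro _ ⟨y, rfl⟩; exact hc0 _ _⟩ ⟨x, hx⟩

lemma continuous_ctilde {c : Euc d → Euc d → ℝ}
    (hc : Continuous fun q : Euc d × Euc d => c q.1 q.2) {Γ : Set (Euc d)} (hΓ : IsCompact Γ) :
    Continuous fun q : Euc d × Euc d => ctilde c Γ q.1 q.2 := by
  have := continuous_cInfOn hc hΓ
  unfold ctilde
  fun_prop

lemma ctilde_nonneg {c : Euc d → Euc d → ℝ} (hc0 : ∀ x y, 0 ≤ c x y) (Γ : Set (Euc d))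
    (x y : Euc d) : 0 ≤ ctilde c Γ x y :=
  le_min (hc0 _ _) (add_nonneg (cInfOn_nonneg hc0 _ _) (cInfOn_nonneg hc0 _ _))

section Marginal

variable {γ : Measure (Euc d × Euc d)} {μ : Measure (Euc d)} {Γ : Set (Euc d)}
  {π : Euc d × Euc d → Euc d}

lemma measure_preimage_of_marginal (hπ : Measurable π) (h : (γ.map π).restrict Γᶜ = μ)
    {s : Set (Euc d)} (hs : MeasurableSet s) (hsΓ : s ⊆ Γᶜ) : γ (π ⁻¹' s) = μ s := by
  rw [← h, Measure.restrict_apply hs, inter_eq_left.2 hsΓ, Measure.map_apply hπ hs]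

lemma lintegral_of_marginal (hπ : Measurable π) (h : (γ.map π).restrict Γᶜ = μ)
    (hΓ : MeasurableSet Γ) {g : Euc d → ℝ≥0∞} (hg : Measurable g) (hg0 : ∀ x ∈ Γ, g x = 0) :
    ∫⁻ q, g (π q) ∂γ = ∫⁻ x, g x ∂μ := by
  have : Γᶜ.indicator g = g := indicator_eq_self.2 fun x hx hxΓ => hx (hg0 x hxΓ)
  rw [← h, ← lintegral_indicator hΓ.compl, this, lintegral_map hg hπ]

lemma integrable_comp_iff_of_marginal (hπ : Measurable π) (h : (γ.map π).restrict Γᶜ = μ)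
    (hΓ : MeasurableSet Γ) {g : Euc d → ℝ} (hg : Measurable g) (hg0 : ∀ x ∈ Γ, g x = 0) :
    Integrable (fun q => g (π q)) γ ↔ Integrable g μ := by
  have : Γᶜ.indicator g = g := indicator_eq_self.2 fun x hx hxΓ => hx (hg0 x hxΓ)
  rw [← h, ← IntegrableOn, ← integrable_indicator_iff hΓ.compl, this,
    integrable_map_measure hg.aestronglyMeasurable hπ.aemeasurable]
  rfl

lemma integral_of_marginal (hπ : Measurable π) (h : (γ.map π).restrict Γᶜ = μ)
    (hΓ : MeasurableSet Γ) {g : Euc d → ℝ} (hg : Measurable g) (hg0 : ∀ x ∈ Γ, g x = 0) :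
    ∫ q, g (π q) ∂γ = ∫ x, g x ∂μ := by
  have : Γᶜ.indicator g = g := indicator_eq_self.2 fun x hx hxΓ => hx (hg0 x hxΓ)
  rw [← h, ← integral_indicator hΓ.compl, this,
    integral_map hπ.aemeasurable hg.aestronglyMeasurable]

end Marginal

/-- The plans of `AdmGamma`, without the requirement that `Γ × Γ` be a null set. -/
def relaxedAdmGamma (Ω Γ : Set (Euc d)) (μ ν : Measure (Euc d)) : Set (Measure (Euc d × Euc d)) :=
  {γ | γ (closure Ω ×ˢ closure Ω)ᶜ = 0 ∧
    (γ.map Prod.fst).restrict Γᶜ = μ ∧ (γ.map Prod.snd).restrict Γᶜ = ν}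

lemma admGamma_subset_relaxedAdmGamma (Ω Γ : Set (Euc d)) (μ ν : Measure (Euc d)) :
    AdmGamma Ω Γ μ ν ⊆ relaxedAdmGamma Ω Γ μ ν :=
  fun _ h => ⟨h.1, h.2.2⟩

lemma sigmaFinite_of_mem_admGamma {Ω Γ : Set (Euc d)} (hΓ : IsClosed Γ) (hΓne : Γ.Nonempty)
    {μ ν : Measure (Euc d)} (hμ : ∀ r : ℝ, 0 < r → μ {x | r < infDist x Γ} < ⊤)
    (hν : ∀ r : ℝ, 0 < r → ν {x | r < infDist x Γ} < ⊤)
    {γ : Measure (Euc d × Euc d)} (hγ : γ ∈ AdmGamma Ω Γ μ ν) : SigmaFinite γ := by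
  let T : ℕ → Set (Euc d) := fun n => {x | 1 / ((n : ℝ) + 1) < infDist x Γ}
  have hTm : ∀ n, MeasurableSet (T n) := fun n =>
    (isOpen_lt continuous_const (continuous_infDist_pt Γ)).measurableSet
  have hTΓ : ∀ n, T n ⊆ Γᶜ := by
    intro n x hx hxΓ
    have h1 : 1 / ((n : ℝ) + 1) < infDist x Γ := hx
    rw [infDist_zero_of_mem hxΓ] at h1
    exact absurd h1 (not_lt.2 (by positivity))
  have hTcov : ∀ x ∉ Γ, ∃ n, x ∈ T n := fun x hx =>
    exists_nat_one_div_lt ((hΓ.notMem_iff_infDist_pos hΓne).1 hx)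
  refine Measure.sigmaFinite_of_countable
    (S := {Γ ×ˢ Γ} ∪ range (fun n => Prod.fst ⁻¹' T n) ∪ range (fun n => Prod.snd ⁻¹' T n))
    (((countable_singleton _).union (countable_range _)).union (countable_range _)) ?_ ?_
  · rintro s ((rfl | ⟨n, rfl⟩) | ⟨n, rfl⟩)
    · simp [hγ.2.1]
    · rw [measure_preimage_of_marginal measurable_fst hγ.2.2.1 (hTm n) (hTΓ n)]
      exact hμ _ (by positivity)
    · rw [measure_preimage_of_marginal measurable_snd hγ.2.2.2 (hTm n) (hTΓ n)]
      exact hν _ (by positivity)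
  · rw [eq_univ_iff_forall]
    intro q
    by_cases h1 : q.1 ∈ Γ
    · by_cases h2 : q.2 ∈ Γ
      · exact ⟨_, Or.inl (Or.inl rfl), h1, h2⟩
      · obtain ⟨n, hn⟩ := hTcov _ h2
        exact ⟨_, Or.inr ⟨n, rfl⟩, hn⟩
    · obtain ⟨n, hn⟩ := hTcov _ h1
      exact ⟨_, Or.inl (Or.inr ⟨n, rfl⟩), hn⟩

section Boundary

variable {Ω Γ : Set (Euc d)} {c : Euc d → Euc d → ℝ} {μ ν : Measure (Euc d)}

lemma Jc_ctilde_lt_top (hΓ : IsCompact Γ)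
    (hc : Continuous fun q : Euc d × Euc d => c q.1 q.2) (hc0 : ∀ x y, 0 ≤ c x y)
    (hczero : ∀ x ∈ Γ, c x x = 0)
    (hμ : ∫⁻ x, ENNReal.ofReal (cInfOn c Γ x) ∂μ < ⊤)
    (hν : ∫⁻ x, ENNReal.ofReal (cInfOn c Γ x) ∂ν < ⊤)
    {γ : Measure (Euc d × Euc d)} (hγ : γ ∈ relaxedAdmGamma Ω Γ μ ν) :
    Jc (ctilde c Γ) γ < ⊤ := by
  have hg : Measurable fun x => ENNReal.ofReal (cInfOn c Γ x) :=
    (continuous_cInfOn hc hΓ).measurable.ennreal_ofReal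
  have hg0 : ∀ x ∈ Γ, ENNReal.ofReal (cInfOn c Γ x) = 0 := fun x hx => by
    rw [cInfOn_eq_zero hc0 hx (hczero x hx), ENNReal.ofReal_zero]
  calc Jc (ctilde c Γ) γ
      ≤ ∫⁻ q, (ENNReal.ofReal (cInfOn c Γ q.1) + ENNReal.ofReal (cInfOn c Γ q.2)) ∂γ :=
        lintegral_mono fun q =>
          (ENNReal.ofReal_le_ofReal (min_le_right _ _)).trans ENNReal.ofReal_add_le
    _ = ∫⁻ x, ENNReal.ofReal (cInfOn c Γ x) ∂μ + ∫⁻ x, ENNReal.ofReal (cInfOn c Γ x) ∂ν := by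
        have hg1 : Measurable fun q : Euc d × Euc d => ENNReal.ofReal (cInfOn c Γ q.1) :=
          hg.comp measurable_fst
        rw [lintegral_add_left hg1,
          lintegral_of_marginal measurable_fst hγ.2.1 hΓ.measurableSet hg hg0,
          lintegral_of_marginal measurable_snd hγ.2.2 hΓ.measurableSet hg hg0]
    _ < ⊤ := ENNReal.add_lt_top.2 ⟨hμ, hν⟩

/-- Sending through `Γ` the mass for which this is cheaper turns the cost `ctilde` into `c`. -/
lemma exists_mem_admGamma_Jc_le (hΓ : IsCompact Γ) (hΓsub : Γ ⊆ closure Ω)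
    (hc : Continuous fun q : Euc d × Euc d => c q.1 q.2) (hc0 : ∀ x y, 0 ≤ c x y)
    (hcsymm : ∀ x ∈ closure Ω, ∀ y ∈ closure Ω, c x y = c y x)
    {P : Euc d → Euc d} (hPmeas : Measurable P) (hPΓ : ∀ x ∈ closure Ω, P x ∈ Γ)
    (hPproj : ∀ x ∈ closure Ω, c x (P x) = cInfOn c Γ x)
    {γ : Measure (Euc d × Euc d)} (hγ : γ ∈ relaxedAdmGamma Ω Γ μ ν) :
    ∃ γ' ∈ AdmGamma Ω Γ μ ν, Jc c γ' ≤ Jc (ctilde c Γ) γ := by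
  obtain ⟨hγX, hγ1, hγ2⟩ := hγ
  have hg : Continuous (cInfOn c Γ) := continuous_cInfOn hc hΓ
  have hΓm : MeasurableSet Γ := hΓ.measurableSet
  let K : Set (Euc d × Euc d) := {q | c q.1 q.2 ≤ cInfOn c Γ q.1 + cInfOn c Γ q.2}
  have hKm : MeasurableSet K := (isClosed_le hc (by fun_prop)).measurableSet
  let K₁ : Set (Euc d × Euc d) := Kᶜ ∩ Prod.fst ⁻¹' Γᶜ
  let K₂ : Set (Euc d × Euc d) := Kᶜ ∩ Prod.snd ⁻¹' Γᶜ
  let T₁ : Euc d × Euc d → Euc d × Euc d := fun q => (q.1, P q.1)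
  let T₂ : Euc d × Euc d → Euc d × Euc d := fun q => (P q.2, q.2)
  have hT₁ : Measurable T₁ := measurable_fst.prodMk (hPmeas.comp measurable_fst)
  have hT₂ : Measurable T₂ := (hPmeas.comp measurable_snd).prodMk measurable_snd
  have hX : ∀ᵐ q ∂γ, q ∈ closure Ω ×ˢ closure Ω := hγX
  have hXm : MeasurableSet (closure Ω ×ˢ closure Ω) :=
    isClosed_closure.measurableSet.prod isClosed_closure.measurableSet
  set γ' : Measure (Euc d × Euc d) :=
    γ.restrict (K \ Γ ×ˢ Γ) + (γ.restrict K₁).map T₁ + (γ.restrict K₂).map T₂ with hγ'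
  have apply_eq : ∀ s, MeasurableSet s →
      γ' s = γ (s ∩ (K \ Γ ×ˢ Γ)) + γ (T₁ ⁻¹' s ∩ K₁) + γ (T₂ ⁻¹' s ∩ K₂) := by
    intro s hs
    simp only [hγ', Measure.add_apply, Measure.map_apply hT₁ hs, Measure.map_apply hT₂ hs,
      Measure.restrict_apply hs, Measure.restrict_apply (hT₁ hs), Measure.restrict_apply (hT₂ hs)]
  have null : ∀ s : Set (Euc d × Euc d), (∀ q ∈ closure Ω ×ˢ closure Ω, q ∉ s) → γ s = 0 :=
    fun s hs => measure_mono_null (fun q hq hqX => hs q hqX hq) hγX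
  refine ⟨γ', ⟨?_, ?_, ?_, ?_⟩, ?_⟩
  · rw [apply_eq _ hXm.compl, null, null, null, add_zero, add_zero]
    · exact fun q hq h => h.1 ⟨hΓsub (hPΓ _ hq.2), hq.2⟩
    · exact fun q hq h => h.1 ⟨hq.1, hΓsub (hPΓ _ hq.1)⟩
    · exact fun q hq h => h.1 hq
  · rw [apply_eq _ (hΓm.prod hΓm), null, null, null, add_zero, add_zero]
    · exact fun q hq h => h.2.2 h.1.2
    · exact fun q hq h => h.2.2 h.1.1
    · exact fun q hq h => h.2.2 h.1
  · rw [← hγ1]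
    ext s hs
    have hs' : MeasurableSet (s ∩ Γᶜ) := hs.inter hΓm.compl
    rw [Measure.restrict_apply hs, Measure.restrict_apply hs, Measure.map_apply measurable_fst hs',
      Measure.map_apply measurable_fst hs', apply_eq _ (measurable_fst hs'),
      null (T₂ ⁻¹' _ ∩ K₂) fun q hq h => h.1.2 (hPΓ _ hq.2), add_zero,
      ← measure_inter_add_sdiff (Prod.fst ⁻¹' (s ∩ Γᶜ)) hKm]
    congr 2
    · ext q
      simp only [mem_inter_iff, mem_preimage, Set.mem_sdiff, mem_prod, mem_compl_iff]
      tauto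
    · ext q
      simp only [T₁, K₁, mem_inter_iff, mem_preimage, Set.mem_sdiff, mem_compl_iff]
      tauto
  · rw [← hγ2]
    ext s hs
    have hs' : MeasurableSet (s ∩ Γᶜ) := hs.inter hΓm.compl
    rw [Measure.restrict_apply hs, Measure.restrict_apply hs, Measure.map_apply measurable_snd hs',
      Measure.map_apply measurable_snd hs', apply_eq _ (measurable_snd hs'),
      null (T₁ ⁻¹' _ ∩ K₁) fun q hq h => h.1.2 (hPΓ _ hq.1), add_zero,
      ← measure_inter_add_sdiff (Prod.snd ⁻¹' (s ∩ Γᶜ)) hKm]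
    congr 2
    · ext q
      simp only [mem_inter_iff, mem_preimage, Set.mem_sdiff, mem_prod, mem_compl_iff]
      tauto
    · ext q
      simp only [T₂, K₂, mem_inter_iff, mem_preimage, Set.mem_sdiff, mem_compl_iff]
      tauto
  · have hcm : Measurable fun q : Euc d × Euc d => ENNReal.ofReal (c q.1 q.2) :=
      hc.measurable.ennreal_ofReal
    have hgm : Measurable fun q : Euc d × Euc d => ENNReal.ofReal (cInfOn c Γ q.1) :=
      (hg.measurable.comp measurable_fst).ennreal_ofReal
    have b₀ : ∫⁻ q in K \ Γ ×ˢ Γ, ENNReal.ofReal (c q.1 q.2) ∂γ ≤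
        ∫⁻ q in K, ENNReal.ofReal (ctilde c Γ q.1 q.2) ∂γ := by
      refine (lintegral_mono_set sdiff_subset).trans (setLIntegral_mono' hKm fun q hq => ?_)
      exact ENNReal.ofReal_le_ofReal (le_min le_rfl hq)
    have b₁ : ∫⁻ q, ENNReal.ofReal (c q.1 q.2) ∂((γ.restrict K₁).map T₁) ≤
        ∫⁻ q in Kᶜ, ENNReal.ofReal (cInfOn c Γ q.1) ∂γ := by
      rw [lintegral_map hcm hT₁]
      refine (lintegral_mono_set inter_subset_left).trans (lintegral_mono_ae ?_)
      filter_upwards [ae_restrict_of_ae hX] with q hq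
      simp only [T₁, hPproj _ hq.1, le_refl]
    have b₂ : ∫⁻ q, ENNReal.ofReal (c q.1 q.2) ∂((γ.restrict K₂).map T₂) ≤
        ∫⁻ q in Kᶜ, ENNReal.ofReal (cInfOn c Γ q.2) ∂γ := by
      rw [lintegral_map hcm hT₂]
      refine (lintegral_mono_set inter_subset_left).trans (lintegral_mono_ae ?_)
      filter_upwards [ae_restrict_of_ae hX] with q hq
      simp only [T₂, hcsymm _ (hΓsub (hPΓ _ hq.2)) _ hq.2, hPproj _ hq.2, le_refl]
    calc Jc c γ' ≤ ∫⁻ q in K, ENNReal.ofReal (ctilde c Γ q.1 q.2) ∂γ +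
          ∫⁻ q in Kᶜ, ENNReal.ofReal (cInfOn c Γ q.1) ∂γ +
          ∫⁻ q in Kᶜ, ENNReal.ofReal (cInfOn c Γ q.2) ∂γ := by
          simp only [Jc, hγ', lintegral_add_measure]
          gcongr
      _ = ∫⁻ q in K, ENNReal.ofReal (ctilde c Γ q.1 q.2) ∂γ +
          ∫⁻ q in Kᶜ, ENNReal.ofReal (ctilde c Γ q.1 q.2) ∂γ := by
          rw [add_assoc, ← lintegral_add_left hgm]
          congr 1
          refine setLIntegral_congr_fun hKm.compl fun q hq => ?_
          have : cInfOn c Γ q.1 + cInfOn c Γ q.2 ≤ c q.1 q.2 :=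
            le_of_not_ge (mem_compl_iff _ _ |>.1 hq)
          simp only [ctilde, min_eq_right this,
            ENNReal.ofReal_add (cInfOn_nonneg hc0 Γ q.1) (cInfOn_nonneg hc0 Γ q.2)]
      _ = Jc (ctilde c Γ) γ := lintegral_add_compl _ hKm

lemma msupport_eq_support {X : Type*} [TopologicalSpace X] [MeasurableSpace X] (γ : Measure X) :
    msupport γ = γ.support := by
  ext x
  simp [msupport, Measure.mem_support_iff_forall, pos_iff_ne_zero]

lemma concentrated_and_cyclicallyMonotone_of_minimal (hΓ : IsCompact Γ) (hΓsub : Γ ⊆ closure Ω)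
    (hΓne : Γ.Nonempty)
    (hc : Continuous fun q : Euc d × Euc d => c q.1 q.2) (hc0 : ∀ x y, 0 ≤ c x y)
    (hcsymm : ∀ x ∈ closure Ω, ∀ y ∈ closure Ω, c x y = c y x) (hczero : ∀ x ∈ Γ, c x x = 0)
    {P : Euc d → Euc d} (hPmeas : Measurable P) (hPΓ : ∀ x ∈ closure Ω, P x ∈ Γ)
    (hPproj : ∀ x ∈ closure Ω, c x (P x) = cInfOn c Γ x)
    (hμ : McMem c Ω Γ μ) (hν : McMem c Ω Γ ν)
    {γ : Measure (Euc d × Euc d)} (hγ : γ ∈ AdmGamma Ω Γ μ ν)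
    (hmin : ∀ γ' ∈ AdmGamma Ω Γ μ ν, Jc c γ ≤ Jc c γ') :
    γ (Kset c Ω Γ)ᶜ = 0 ∧ CyclicallyMonotone (ctilde c Γ) (msupport γ ∪ Γ ×ˢ Γ) := by
  have hle : ∀ γ' ∈ relaxedAdmGamma Ω Γ μ ν, Jc c γ ≤ Jc (ctilde c Γ) γ' := by
    intro γ' hγ'
    obtain ⟨γ'', h, hJ⟩ :=
      exists_mem_admGamma_Jc_le hΓ hΓsub hc hc0 hcsymm hPmeas hPΓ hPproj hγ'
    exact (hmin _ h).trans hJ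
  have hrel := admGamma_subset_relaxedAdmGamma _ _ _ _ hγ
  have hfin : Jc (ctilde c Γ) γ < ⊤ :=
    Jc_ctilde_lt_top hΓ hc hc0 hczero hμ.2.2.1 hν.2.2.1 hrel
  have hpt : ∀ q : Euc d × Euc d,
      ENNReal.ofReal (ctilde c Γ q.1 q.2) ≤ ENNReal.ofReal (c q.1 q.2) :=
    fun q => ENNReal.ofReal_le_ofReal (min_le_left _ _)
  have hJle : Jc (ctilde c Γ) γ ≤ Jc c γ := lintegral_mono hpt
  constructor
  · have hae := ae_eq_of_ae_le_of_lintegral_le (Eventually.of_forall hpt) hfin.ne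
      hc.measurable.ennreal_ofReal.aemeasurable (hle γ hrel)
    have hX : ∀ᵐ q ∂γ, q ∈ closure Ω ×ˢ closure Ω := hγ.1
    have : ∀ᵐ q ∂γ, q ∈ Kset c Ω Γ := by
      filter_upwards [hae, hX] with q hq hqX
      rw [ENNReal.ofReal_eq_ofReal_iff (ctilde_nonneg hc0 _ _ _) (hc0 _ _)] at hq
      exact ⟨hqX.1, hqX.2, hq.symm.le.trans (min_le_right _ _)⟩
    exact this
  · intro n q hq σ
    classical
    let δ : Fin n → Measure (Euc d × Euc d) := fun i =>
      if q i ∈ Γ ×ˢ Γ then Measure.dirac (q i) else 0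
    have hδ : ∀ i, IsFiniteMeasure (δ i) := by
      intro i
      simp only [δ]
      split_ifs <;> infer_instance
    have hδΓ : ∀ i s, MeasurableSet s → Disjoint s (Γ ×ˢ Γ) → δ i s = 0 := by
      intro i s hs hd
      simp only [δ]
      split_ifs with h
      · rw [Measure.dirac_apply' _ hs]
        exact indicator_of_notMem (fun h' => hd.notMem_of_mem_right h h') _
      · rfl
    have : SigmaFinite γ :=
      sigmaFinite_of_mem_admGamma hΓ.isClosed hΓne hμ.2.2.2 hν.2.2.2 hγ
    let γ₀ := γ + ∑ i, δ i
    have happly : ∀ s, MeasurableSet s → Disjoint s (Γ ×ˢ Γ) → γ₀ s = γ s := by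
      intro s hs hd
      simp [γ₀, hδΓ _ s hs hd]
    have hXm : MeasurableSet (closure Ω ×ˢ closure Ω) :=
      isClosed_closure.measurableSet.prod isClosed_closure.measurableSet
    have hΓm : MeasurableSet Γ := hΓ.measurableSet
    have hmarg : ∀ π : Euc d × Euc d → Euc d, Measurable π → (∀ q ∈ Γ ×ˢ Γ, π q ∈ Γ) →
        (γ₀.map π).restrict Γᶜ = (γ.map π).restrict Γᶜ := by
      intro π hπ hπΓ
      ext s hs
      have hs' := hs.inter hΓm.compl
      rw [Measure.restrict_apply hs, Measure.restrict_apply hs, Measure.map_apply hπ hs',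
        Measure.map_apply hπ hs', happly _ (hπ hs')]
      exact Set.disjoint_left.2 fun q hq hqΓ => hq.2 (hπΓ q hqΓ)
    have hJ₀ : Jc (ctilde c Γ) γ₀ = Jc (ctilde c Γ) γ := by
      have h0 : ∀ i, ∫⁻ q, ENNReal.ofReal (ctilde c Γ q.1 q.2) ∂(δ i) = 0 := by
        intro i
        simp only [δ]
        split_ifs with h
        · rw [lintegral_dirac' _ (continuous_ctilde hc hΓ).measurable.ennreal_ofReal]
          refine ENNReal.ofReal_eq_zero.2 ((min_le_right _ _).trans ?_)
          rw [cInfOn_eq_zero hc0 h.1 (hczero _ h.1), cInfOn_eq_zero hc0 h.2 (hczero _ h.2),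
            add_zero]
        · simp
      simp [Jc, γ₀, lintegral_add_measure, lintegral_finsetSum_measure, h0]
    refine cyclicallyMonotone_msupport (continuous_ctilde hc hΓ) (ctilde_nonneg hc0 Γ) γ₀
      (hJ₀ ▸ hfin.ne) ?_ n q (fun i => ?_) σ
    · intro γ' h1 h2
      rw [hJ₀]
      refine hJle.trans (hle γ' ⟨?_, ?_, ?_⟩)
      · have hX₀ : γ₀ (closure Ω ×ˢ closure Ω)ᶜ = 0 := by
          rw [happly _ hXm.compl, hγ.1]
          exact disjoint_compl_left_iff_subset.2 (prod_mono hΓsub hΓsub)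
        have hΩm : MeasurableSet (closure Ω)ᶜ := isClosed_closure.measurableSet.compl
        have key : ∀ π : Euc d × Euc d → Euc d, Measurable π → γ'.map π = γ₀.map π →
            (π ⁻¹' (closure Ω)ᶜ ⊆ (closure Ω ×ˢ closure Ω)ᶜ) →
            γ' (π ⁻¹' (closure Ω)ᶜ) = 0 := by
          intro π hπ h hsub
          rw [← Measure.map_apply hπ hΩm, h, Measure.map_apply hπ hΩm]
          exact measure_mono_null hsub hX₀
        refine measure_mono_null ?_ (measure_union_null
          (key _ measurable_fst h1 fun q hq h => hq h.1)
          (key _ measurable_snd h2 fun q hq h => hq h.2))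
        intro q hq
        by_contra hcon
        simp only [mem_union, mem_preimage, mem_compl_iff, not_or, not_not] at hcon
        exact hq hcon
      · rw [h1, hmarg _ measurable_fst fun q hq => hq.1, hγ.2.2.1]
      · rw [h2, hmarg _ measurable_snd fun q hq => hq.2, hγ.2.2.2]
    · intro U hU
      rcases hq i with h | h
      · exact fun h0 => h U hU (le_antisymm ((Measure.le_add_right le_rfl U).trans h0.le) bot_le)
      · intro h0
        have h1 : δ i U ≤ γ₀ U := by
          simp only [γ₀, Measure.add_apply, Measure.finsetSum_apply]
          exact (Finset.single_le_sum (f := fun j => δ j U) (fun _ _ => bot_le)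
            (Finset.mem_univ i)).trans le_add_self
        rw [h0] at h1
        simp only [δ, if_pos h, Measure.dirac_apply_of_mem (mem_of_mem_nhds hU)] at h1
        exact absurd h1 (by simp)

lemma minimal_of_concentrated_of_cyclicallyMonotone (hΓ : IsCompact Γ) (hΓne : Γ.Nonempty)
    (hc : Continuous fun q : Euc d × Euc d => c q.1 q.2) (hc0 : ∀ x y, 0 ≤ c x y)
    (hczero : ∀ x ∈ Γ, c x x = 0) (hμ : McMem c Ω Γ μ) (hν : McMem c Ω Γ ν)
    {γ : Measure (Euc d × Euc d)} (hγ : γ ∈ AdmGamma Ω Γ μ ν) (hK : γ (Kset c Ω Γ)ᶜ = 0)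
    (hcm : CyclicallyMonotone (ctilde c Γ) (msupport γ ∪ Γ ×ˢ Γ))
    {γ' : Measure (Euc d × Euc d)} (hγ' : γ' ∈ AdmGamma Ω Γ μ ν) : Jc c γ ≤ Jc c γ' := by
  have hΓm : MeasurableSet Γ := hΓ.measurableSet
  set f := ctilde c Γ with hf_def
  set g := cInfOn c Γ with hg_def
  set S := msupport γ ∪ Γ ×ˢ Γ with hS_def
  have hfc : Continuous fun q : Euc d × Euc d => f q.1 q.2 := continuous_ctilde hc hΓ
  have hf0 : ∀ x y, 0 ≤ f x y := ctilde_nonneg hc0 Γ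
  have hg0 : ∀ x ∈ Γ, g x = 0 := fun x hx => cInfOn_eq_zero hc0 hx (hczero x hx)
  have hfg : ∀ x y, f x y ≤ g x + g y := fun x y => min_le_right _ _
  have hSc : IsClosed S := by
    rw [hS_def, msupport_eq_support]
    exact Measure.isClosed_support.union (hΓ.isClosed.prod hΓ.isClosed)
  have hproj : ∀ π : Euc d × Euc d → Euc d, Continuous π → MeasurableSet (π '' S) := by
    intro π hπ
    obtain ⟨T, hT, hTS⟩ :=
      (isSigmaCompact_univ.of_isClosed_subset hSc (subset_univ S)).image hπ
    rw [← hTS]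
    exact MeasurableSet.iUnion fun n => (hT n).measurableSet
  have hA := hproj _ continuous_fst
  have hB := hproj _ continuous_snd
  have hΓS : ∀ x ∈ Γ, ∀ y ∈ Γ, (x, y) ∈ S := fun x hx y hy => Or.inr ⟨hx, hy⟩
  obtain ⟨a, ha⟩ := hΓne
  have hΓA : ∀ x ∈ Γ, x ∈ Prod.fst '' S := fun x hx => ⟨(x, a), hΓS x hx a ha, rfl⟩
  have hΓB : ∀ y ∈ Γ, y ∈ Prod.snd '' S := fun y hy => ⟨(a, y), hΓS a ha y hy, rfl⟩
  obtain ⟨φ, ψ, hφm, hψm, hφa, hle, heq⟩ :=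
    hcm.exists_potentials hfc (hΓS a ha a ha) hA hB
  have hfΓ : ∀ x ∈ Γ, ∀ y ∈ Γ, f x y = 0 := fun x hx y hy =>
    le_antisymm ((hfg x y).trans (by rw [hg0 x hx, hg0 y hy, add_zero])) (hf0 x y)
  have hψ0 : ∀ y ∈ Γ, ψ y = 0 := fun y hy => by
    have := heq _ (hΓS a ha y hy)
    simp only [hφa, hfΓ a ha y hy] at this
    linarith
  have hφ0 : ∀ x ∈ Γ, φ x = 0 := fun x hx => by
    have := heq _ (hΓS x hx a ha)
    simp only [hψ0 a ha, hfΓ x hx a ha] at this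
    linarith
  have hφg : ∀ x ∈ Prod.fst '' S, φ x ≤ g x := fun x hx => by
    have h1 := hle x hx a (hΓB a ha)
    have h2 := hfg x a
    rw [hψ0 a ha] at h1
    rw [hg0 a ha] at h2
    linarith
  have hψg : ∀ y ∈ Prod.snd '' S, ψ y ≤ g y := fun y hy => by
    have h1 := hle a (hΓA a ha) y hy
    have h2 := hfg a y
    rw [hφa] at h1
    rw [hg0 a ha] at h2
    linarith
  have hS : ∀ᵐ q ∂γ, q ∈ S := by
    have h0 : γ (msupport γ)ᶜ = 0 := by
      rw [msupport_eq_support]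
      exact Measure.measure_compl_support
    exact measure_mono_null (compl_subset_compl.2 subset_union_left) h0
  have hf_int : ∀ γ₁ ∈ AdmGamma Ω Γ μ ν, Integrable (fun q => f q.1 q.2) γ₁ := by
    intro γ₁ hγ₁
    refine ⟨hfc.aestronglyMeasurable, ?_⟩
    rw [hasFiniteIntegral_iff_ofReal (Eventually.of_forall fun q => hf0 _ _)]
    exact Jc_ctilde_lt_top hΓ hc hc0 hczero hμ.2.2.1 hν.2.2.1
      (admGamma_subset_relaxedAdmGamma _ _ _ _ hγ₁)
  have hgc : Continuous g := continuous_cInfOn hc hΓ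
  have hgn : ∀ x, 0 ≤ g x := cInfOn_nonneg hc0 Γ
  have hg_int : ∀ m : Measure (Euc d), ∫⁻ x, ENNReal.ofReal (g x) ∂m < ⊤ → Integrable g m :=
    fun m hm => ⟨hgc.aestronglyMeasurable,
      (hasFiniteIntegral_iff_ofReal (Eventually.of_forall hgn)).2 hm⟩
  have hG_int : Integrable (fun q : Euc d × Euc d => g q.1 + g q.2) γ :=
    ((integrable_comp_iff_of_marginal measurable_fst hγ.2.2.1 hΓm hgc.measurable hg0).2
      (hg_int μ hμ.2.2.1)).add
    ((integrable_comp_iff_of_marginal measurable_snd hγ.2.2.2 hΓm hgc.measurable hg0).2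
      (hg_int ν hν.2.2.1))
  have hbound : ∀ q ∈ S, |φ q.1| ≤ g q.1 + g q.2 ∧ |ψ q.2| ≤ g q.1 + g q.2 := by
    intro q hq
    have h1 := hφg q.1 ⟨q, hq, rfl⟩
    have h2 := hψg q.2 ⟨q, hq, rfl⟩
    have h3 := heq q hq
    have h4 := hf0 q.1 q.2
    have h5 := hgn q.1
    have h6 := hgn q.2
    exact ⟨abs_le.2 ⟨by linarith, by linarith⟩, abs_le.2 ⟨by linarith, by linarith⟩⟩
  have hφμ : Integrable φ μ := by
    refine (integrable_comp_iff_of_marginal measurable_fst hγ.2.2.1 hΓm hφm hφ0).1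
      (hG_int.mono' (hφm.comp measurable_fst).aestronglyMeasurable ?_)
    filter_upwards [hS] with q hq using (hbound q hq).1
  have hψν : Integrable ψ ν := by
    refine (integrable_comp_iff_of_marginal measurable_snd hγ.2.2.2 hΓm hψm hψ0).1
      (hG_int.mono' (hψm.comp measurable_snd).aestronglyMeasurable ?_)
    filter_upwards [hS] with q hq using (hbound q hq).2
  have hsum_int : ∀ γ₁ ∈ AdmGamma Ω Γ μ ν, Integrable (fun q => φ q.1 + ψ q.2) γ₁ ∧
      ∫ q, (φ q.1 + ψ q.2) ∂γ₁ = ∫ x, φ x ∂μ + ∫ y, ψ y ∂ν := by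
    intro γ₁ hγ₁
    have i1 := (integrable_comp_iff_of_marginal measurable_fst hγ₁.2.2.1 hΓm hφm hφ0).2 hφμ
    have i2 := (integrable_comp_iff_of_marginal measurable_snd hγ₁.2.2.2 hΓm hψm hψ0).2 hψν
    refine ⟨i1.add i2, ?_⟩
    rw [integral_add i1 i2, integral_of_marginal measurable_fst hγ₁.2.2.1 hΓm hφm hφ0,
      integral_of_marginal measurable_snd hγ₁.2.2.2 hΓm hψm hψ0]
  have transfer : ∀ (π : Euc d × Euc d → Euc d) (m : Measure (Euc d)), Measurable π →
      (γ.map π).restrict Γᶜ = m → (γ'.map π).restrict Γᶜ = m → MeasurableSet (π '' S) →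
      (∀ x ∈ Γ, x ∈ π '' S) → ∀ᵐ q ∂γ', π q ∈ π '' S := by
    intro π m hπ h h' hm hsub
    have hc' : (π '' S)ᶜ ⊆ Γᶜ := compl_subset_compl.2 hsub
    change γ' (π ⁻¹' (π '' S)ᶜ) = 0
    rw [measure_preimage_of_marginal hπ h' hm.compl hc',
      ← measure_preimage_of_marginal hπ h hm.compl hc']
    exact measure_mono_null (fun q hq hqS => hq ⟨q, hqS, rfl⟩) hS
  have hint_le : ∫ q, f q.1 q.2 ∂γ ≤ ∫ q, f q.1 q.2 ∂γ' := by
    calc ∫ q, f q.1 q.2 ∂γ = ∫ q, (φ q.1 + ψ q.2) ∂γ := by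
          refine integral_congr_ae ?_
          filter_upwards [hS] with q hq using (heq q hq).symm
      _ = ∫ q, (φ q.1 + ψ q.2) ∂γ' := by rw [(hsum_int γ hγ).2, (hsum_int γ' hγ').2]
      _ ≤ ∫ q, f q.1 q.2 ∂γ' := by
          refine integral_mono_ae (hsum_int γ' hγ').1 (hf_int γ' hγ') ?_
          filter_upwards [transfer _ μ measurable_fst hγ.2.2.1 hγ'.2.2.1 hA hΓA,
            transfer _ ν measurable_snd hγ.2.2.2 hγ'.2.2.2 hB hΓB] with q h1 h2
          exact hle _ h1 _ h2
  have hKae : ∀ᵐ q ∂γ, q ∈ Kset c Ω Γ := hK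
  calc Jc c γ = Jc f γ := by
        refine lintegral_congr_ae ?_
        filter_upwards [hKae] with q hq
        simp only [hf_def, ctilde, min_eq_left hq.2.2]
    _ ≤ Jc f γ' := by
        rw [Jc, Jc, ← ofReal_integral_eq_lintegral_ofReal (hf_int γ hγ)
            (Eventually.of_forall fun q => hf0 _ _),
          ← ofReal_integral_eq_lintegral_ofReal (hf_int γ' hγ')
            (Eventually.of_forall fun q => hf0 _ _)]
        exact ENNReal.ofReal_le_ofReal hint_le
    _ ≤ Jc c γ' := lintegral_mono fun q => ENNReal.ofReal_le_ofReal (min_le_left _ _)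

end Boundary

lemma CyclicallyMonotone.congr {f g : Euc d → Euc d → ℝ} {X : Set (Euc d)}
    {S : Set (Euc d × Euc d)} (hS : S ⊆ X ×ˢ X) (hfg : ∀ x ∈ X, ∀ y ∈ X, f x y = g x y)
    (h : CyclicallyMonotone f S) : CyclicallyMonotone g S := by
  intro n q hq σ
  have := h n q hq σ
  rwa [Finset.sum_congr rfl fun i _ => hfg _ (hS (hq i)).1 _ (hS (hq i)).2,
    Finset.sum_congr rfl fun i _ => hfg _ (hS (hq i)).1 _ (hS (hq (σ i))).2] at this

/-- A continuous nonnegative cost on a closed set extends to the whole space. -/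
lemma exists_continuous_extension {X : Set (Euc d)} (hX : IsClosed X) {c : Euc d → Euc d → ℝ}
    (hc : ContinuousOn (fun q : Euc d × Euc d => c q.1 q.2) (X ×ˢ X))
    (hc0 : ∀ x ∈ X, ∀ y ∈ X, 0 ≤ c x y) :
    ∃ C : Euc d → Euc d → ℝ, (Continuous fun q : Euc d × Euc d => C q.1 q.2) ∧
      (∀ x y, 0 ≤ C x y) ∧ ∀ x ∈ X, ∀ y ∈ X, C x y = c x y := by
  obtain ⟨G, hG⟩ := ContinuousMap.exists_restrict_eq (hX.prod hX)
    ⟨(X ×ˢ X).domRestrict fun q : Euc d × Euc d => c q.1 q.2,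
      continuousOn_iff_continuous_domRestrict.1 hc⟩
  refine ⟨fun x y => max (G (x, y)) 0, by fun_prop, fun x y => le_max_right _ _,
    fun x hx y hy => ?_⟩
  have : G (x, y) = c x y :=
    congrArg (fun h : C((X ×ˢ X : Set (Euc d × Euc d)), ℝ) => h ⟨(x, y), hx, hy⟩) hG
  simp only [this, max_eq_left (hc0 x hx y hy)]

/-- Theorem A.10 (characterization of optimal plans for transport with boundary): an
admissible coupling `γ` minimizes `J_c` over `Adm_Γ(μ,ν)` if and only if `γ` is
concentrated on `𝒦` and `spt(γ) ∪ (Γ×Γ)` is `c̃`-cyclically monotone. -/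
theorem optimal_plan_characterization
    {d : ℕ} (Ω Γ : Set (Euc d)) (hΩ : IsOpen Ω) (hΓcpt : IsCompact Γ)
    (hΓsub : Γ ⊆ closure Ω) (hΓne : Γ.Nonempty)
    (c : Euc d → Euc d → ℝ)
    (hccont : ContinuousOn (fun q : Euc d × Euc d => c q.1 q.2) (closure Ω ×ˢ closure Ω))
    (hcsymm : ∀ x ∈ closure Ω, ∀ y ∈ closure Ω, c x y = c y x)
    (hczero : ∀ x ∈ closure Ω, c x x = 0)
    (hcpos : ∀ x ∈ closure Ω, ∀ y ∈ closure Ω, x ≠ y → 0 < c x y)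
    (P : Euc d → Euc d) (hPmeas : Measurable P)
    (hPΓ : ∀ x ∈ closure Ω, P x ∈ Γ)
    (hPproj : ∀ x ∈ closure Ω, c x (P x) = cInfOn c Γ x)
    (μ ν : Measure (Euc d)) (hμ : McMem c Ω Γ μ) (hν : McMem c Ω Γ ν)
    (γ : Measure (Euc d × Euc d)) (hγ : γ ∈ AdmGamma Ω Γ μ ν) :
    (∀ γ' ∈ AdmGamma Ω Γ μ ν, Jc c γ ≤ Jc c γ') ↔
      (γ (Kset c Ω Γ)ᶜ = 0 ∧ CyclicallyMonotone (ctilde c Γ) (msupport γ ∪ Γ ×ˢ Γ)) := by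
  set X := closure Ω with hX
  have hXc : IsClosed X := isClosed_closure
  have hc0 : ∀ x ∈ X, ∀ y ∈ X, 0 ≤ c x y := by
    intro x hx y hy
    by_cases h : x = y
    · rw [h, hczero y hy]
    · exact (hcpos x hx y hy h).le
  obtain ⟨C, hC, hC0, hCc⟩ := exists_continuous_extension hXc hccont hc0
  have hg : ∀ x ∈ X, cInfOn C Γ x = cInfOn c Γ x := fun x hx =>
    iInf_congr fun y => hCc x hx y (hΓsub y.2)
  have hct : ∀ x ∈ X, ∀ y ∈ X, ctilde C Γ x y = ctilde c Γ x y := fun x hx y hy => by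
    simp only [ctilde, hCc x hx y hy, hg x hx, hg y hy]
  have hJ : ∀ γ' ∈ AdmGamma Ω Γ μ ν, Jc C γ' = Jc c γ' := by
    intro γ' hγ'
    have hae : ∀ᵐ q ∂γ', q ∈ X ×ˢ X := hγ'.1
    refine lintegral_congr_ae ?_
    filter_upwards [hae] with q hq
    rw [hCc _ hq.1 _ hq.2]
  have hKs : Kset C Ω Γ = Kset c Ω Γ := by
    ext q
    refine and_congr_right fun h1 => and_congr_right fun h2 => ?_
    rw [hCc _ h1 _ h2, hg _ h1, hg _ h2]
  have hMc : ∀ m : Measure (Euc d), McMem c Ω Γ m → McMem C Ω Γ m := by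
    intro m hm
    have hae : ∀ᵐ x ∂m, x ∈ X := hm.1
    refine ⟨hm.1, hm.2.1, lt_of_eq_of_lt (lintegral_congr_ae ?_) hm.2.2.1, hm.2.2.2⟩
    filter_upwards [hae] with x hx
    rw [hg x hx]
  have hS : msupport γ ∪ Γ ×ˢ Γ ⊆ X ×ˢ X := by
    refine union_subset (fun q hq => ?_) (prod_mono hΓsub hΓsub)
    by_contra hqX
    exact hq _ ((hXc.prod hXc).isOpen_compl.mem_nhds hqX) hγ.1
  have hCzero : ∀ x ∈ Γ, C x x = 0 := fun x hx => by
    rw [hCc x (hΓsub hx) x (hΓsub hx), hczero x (hΓsub hx)]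
  constructor
  · intro hmin
    have := concentrated_and_cyclicallyMonotone_of_minimal (P := P) hΓcpt hΓsub hΓne hC hC0
      (fun x hx y hy => by rw [hCc x hx y hy, hCc y hy x hx, hcsymm x hx y hy]) hCzero hPmeas hPΓ
      (fun x hx => by rw [hCc x hx _ (hΓsub (hPΓ x hx)), hg x hx, hPproj x hx])
      (hMc μ hμ) (hMc ν hν) hγ (fun γ' hγ' => by rw [hJ γ hγ, hJ γ' hγ']; exact hmin γ' hγ')
    exact ⟨hKs ▸ this.1, this.2.congr hS hct⟩
  · rintro ⟨hK, hcm⟩ γ' hγ'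
    rw [← hJ γ hγ, ← hJ γ' hγ']
    exact minimal_of_concentrated_of_cyclicallyMonotone hΓcpt hΓne hC hC0 hCzero (hMc μ hμ)
      (hMc ν hν) hγ (hKs.symm ▸ hK) (hcm.congr hS fun x hx y hy => (hct x hx y hy).symm) hγ'
end
end
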